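/- arXiv:2006.01176 — 6 statements merged into one kernel-verified Lean document; each statement's English description precedes it below -/
import Mathlib

section
/- Let u : R → U be a flat injective ring epimorphism of commutative rings with associated Gabriel topology G and K := U/R. If N is a G-torsion-free R-module, then for every J ∈ G there is an isomorphism Tor_1^R(R/J, N) ≅ Tor_1^R(R/J, Ext^1_R(K, N)). -/
universe u

/-- A Gabriel topology on a commutative ring `R`: a filter of ideals of `R`
satisfying the Gabriel axiom T4. -/
structure GabrielTopology (R : Type u) [CommRing R] : Type u where
  sets : Set (Ideal R)
  top_mem : (⊤ : Ideal R) ∈ sets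
  mem_of_le : ∀ {I J : Ideal R}, I ∈ sets → I ≤ J → J ∈ sets
  inf_mem : ∀ {I J : Ideal R}, I ∈ sets → J ∈ sets → I ⊓ J ∈ sets
  gabriel : ∀ I J : Ideal R, J ∈ sets →
    (∀ r ∈ J, Submodule.colon I (Ideal.span {r}) ∈ sets) → I ∈ sets

namespace GabrielTopology

variable {R : Type u} [CommRing R] (G : GabrielTopology R)

/-- A module `M` is `G`-torsion if the annihilator of every element belongs to `G`. -/
def IsTorsion (M : Type u) [AddCommGroup M] [Module R M] : Prop :=
  ∀ x : M, Ideal.torsionOf R M x ∈ G.sets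

/-- A module `M` is `G`-torsion-free if no nonzero element is annihilated by an ideal of `G`. -/
def IsTorsionFree (M : Type u) [AddCommGroup M] [Module R M] : Prop :=
  ∀ x : M, Ideal.torsionOf R M x ∈ G.sets → x = 0

/-- A module `M` is `G`-divisible if `JM = M` for every `J ∈ G`. -/
def IsDivisible (M : Type u) [AddCommGroup M] [Module R M] : Prop :=
  ∀ J ∈ G.sets, J • (⊤ : Submodule R M) = ⊤

/-- `G` is faithful if `R` is `G`-torsion-free. -/
def Faithful : Prop := ∀ r : R, Ideal.torsionOf R R r ∈ G.sets → r = 0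

/-- `G` is finitely generated if it has a basis of finitely generated ideals. -/
def FinitelyGenerated : Prop := ∀ J ∈ G.sets, ∃ J' ∈ G.sets, J' ≤ J ∧ J'.FG

end GabrielTopology

/-- `Ext¹_R(M, N) = 0`, expressed by the standard characterisation:
every short exact sequence `0 → N → E → M → 0` splits. -/
def Ext1Vanish (R : Type u) [CommRing R] (M N : Type u) [AddCommGroup M] [Module R M]
    [AddCommGroup N] [Module R N] : Prop :=
  ∀ (E : Type u) [AddCommGroup E] [Module R E] (i : N →ₗ[R] E) (p : E →ₗ[R] M),
    Function.Injective i → Function.Surjective p → LinearMap.range i = LinearMap.ker p →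
      ∃ s : M →ₗ[R] E, p ∘ₗ s = LinearMap.id

/-- `M` has projective dimension at most 1: the kernel of a free cover is projective. -/
def ProjDimLE1 (R : Type u) [CommRing R] (M : Type u) [AddCommGroup M] [Module R M] : Prop :=
  ∃ (ι : Type u) (p : (ι →₀ R) →ₗ[R] M),
    Function.Surjective p ∧ Module.Projective R ↥(LinearMap.ker p)

/-- `M ∈ Add(T)`: `M` is a direct summand of a direct sum of copies of `T`. -/
def InAdd (R : Type u) [CommRing R] (T M : Type u) [AddCommGroup T] [Module R T]
    [AddCommGroup M] [Module R M] : Prop :=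
  ∃ (ι : Type u) (s : M →ₗ[R] (ι →₀ T)) (r : (ι →₀ T) →ₗ[R] M), r ∘ₗ s = LinearMap.id

/-- `T` is a 1-tilting module: (T1) `p.dim T ≤ 1`, (T2) `Ext¹(T, T^(κ)) = 0` for all κ,
(T3) there is an exact sequence `0 → R → T₀ → T₁ → 0` with `T₀, T₁ ∈ Add(T)`. -/
def Is1Tilting (R : Type u) [CommRing R] (T : Type u) [AddCommGroup T] [Module R T] : Prop :=
  ProjDimLE1 R T ∧
  (∀ ι : Type u, Ext1Vanish R T (ι →₀ T)) ∧
  ∃ (T0 T1 : ModuleCat.{u} R) (i : R →ₗ[R] ↥T0) (p : ↥T0 →ₗ[R] ↥T1),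
    InAdd R T ↥T0 ∧ InAdd R T ↥T1 ∧
    Function.Injective i ∧ Function.Surjective p ∧ LinearMap.range i = LinearMap.ker p

namespace GabrielTopology

variable {R : Type u} [CommRing R] (G : GabrielTopology R)

/-- `(𝒜, 𝒟_G)` is a 1-tilting cotorsion pair with associated Gabriel topology `G`:
`G` is a faithful finitely generated Gabriel topology and the class of `G`-divisible
modules is the tilting class of a 1-tilting module. -/
def IsTiltingTopology : Prop :=
  G.Faithful ∧ G.FinitelyGenerated ∧
  ∃ T : ModuleCat.{u} R, Is1Tilting R ↥T ∧
    ∀ (M : Type u) [AddCommGroup M] [Module R M], (Ext1Vanish R ↥T M ↔ G.IsDivisible M)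

/-- Membership in the left-hand class `𝒜 = ᗮ(𝒟_G)` of the 1-tilting cotorsion pair. -/
def MemA (M : Type u) [AddCommGroup M] [Module R M] : Prop :=
  ∀ (D : Type u) [AddCommGroup D] [Module R D], G.IsDivisible D → Ext1Vanish R M D

/-- The class `𝒜` is covering: every module has an `𝒜`-cover. -/
def IsACovering : Prop :=
  ∀ (M : Type u) [AddCommGroup M] [Module R M],
    ∃ (C : ModuleCat.{u} R) (φ : ↥C →ₗ[R] M),
      G.MemA ↥C ∧
      (∀ (C' : Type u) [AddCommGroup C'] [Module R C'], G.MemA C' →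
        ∀ f : C' →ₗ[R] M, ∃ g : C' →ₗ[R] ↥C, φ ∘ₗ g = f) ∧
      (∀ e : ↥C →ₗ[R] ↥C, φ ∘ₗ e = φ → Function.Bijective e)

/-- The class `𝒜` is closed under direct limits. -/
def AClosedUnderDirectLimits : Prop :=
  ∀ (ι : Type u) [Preorder ι] [IsDirected ι (· ≤ ·)] [Nonempty ι] [DecidableEq ι]
    (M : ι → Type u) [∀ i, AddCommGroup (M i)] [∀ i, Module R (M i)]
    (f : ∀ i j, i ≤ j → M i →ₗ[R] M j) [DirectedSystem M fun i j h => f i j h],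
    (∀ i, G.MemA (M i)) → G.MemA (Module.DirectLimit M f)

/-- `Q`, via `algebraMap R Q`, is the ring of quotients `R_G` of `R` with respect to `G`:
`Q` is `G`-torsion-free and `G`-injective (i.e. `G`-closed) and the kernel and cokernel
of `R → Q` are `G`-torsion. -/
structure IsRingOfQuotients (Q : Type u) [CommRing Q] [Algebra R Q] : Prop where
  torsionFree : ∀ q : Q, Ideal.torsionOf R Q q ∈ G.sets → q = 0
  gInjective : ∀ J ∈ G.sets, ∀ f : ↥J →ₗ[R] Q, ∃ q : Q, ∀ j : ↥J, f j = (j : R) • q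
  ker_torsion : ∀ r : R, algebraMap R Q r = 0 → Ideal.torsionOf R R r ∈ G.sets
  coker_torsion : ∀ q : Q, ∃ J ∈ G.sets, ∀ x ∈ J, ∃ r : R, x • q = algebraMap R Q r

/-- `G` is a perfect Gabriel topology, realised by the perfect localisation `Q`:
`R → Q` is a flat ring epimorphism and `G = {J ∣ JQ = Q}`. -/
def IsPerfectLocalization (Q : Type u) [CommRing Q] [Algebra R Q] : Prop :=
  Module.Flat R Q ∧
  (∀ (S : Type u) [CommRing S] (f g : Q →+* S),
    f.comp (algebraMap R Q) = g.comp (algebraMap R Q) → f = g) ∧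
  (∀ J : Ideal R, J ∈ G.sets ↔ J • (⊤ : Submodule R Q) = ⊤)

end GabrielTopology

/-- A commutative ring is perfect iff every flat module is projective. -/
def IsPerfectRing (S : Type u) [CommRing S] : Prop :=
  ∀ (M : Type u) [AddCommGroup M] [Module S M], Module.Flat S M → Module.Projective S M

/-- `X` is Σ-pure-split: every pure embedding `A ⊆ B` with `B ∈ Add(X)` splits. -/
def SigmaPureSplit (R : Type u) [CommRing R] (X : Type u) [AddCommGroup X] [Module R X] : Prop :=
  ∀ (A B : Type u) [AddCommGroup A] [Module R A] [AddCommGroup B] [Module R B] (i : A →ₗ[R] B),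
    Function.Injective i →
    (∀ (M : Type u) [AddCommGroup M] [Module R M], Function.Injective (LinearMap.rTensor M i)) →
    InAdd R X B → ∃ r : B →ₗ[R] A, r ∘ₗ i = LinearMap.id

/-- A concrete model of `Ext¹_R(M, N)`, computed from the canonical free presentation
`0 → S → (M →₀ R) → M → 0` of `M` as `coker (Hom((M →₀ R), N) → Hom(S, N))`. -/
abbrev ext1 (R : Type u) [CommRing R] (M N : Type u) [AddCommGroup M] [Module R M]
    [AddCommGroup N] [Module R N] : Type u :=
  (↥(LinearMap.ker (Finsupp.linearCombination R (id : M → M))) →ₗ[R] N) ⧸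
    LinearMap.range
      (LinearMap.lcomp R N (LinearMap.ker (Finsupp.linearCombination R (id : M → M))).subtype)

/-- A concrete model of `Tor₁^R(M, N)`, computed from the canonical free presentation
`0 → S → (M →₀ R) → M → 0` of `M` as `ker (S ⊗ N → (M →₀ R) ⊗ N)`. -/
abbrev tor1 (R : Type u) [CommRing R] (M N : Type u) [AddCommGroup M] [Module R M]
    [AddCommGroup N] [Module R N] : Type u :=
  ↥(LinearMap.ker
    (LinearMap.rTensor N (LinearMap.ker (Finsupp.linearCombination R (id : M → M))).subtype))

/-- The cokernel `U/R` of a ring map `R → U`. -/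
abbrev cokerAlg (R U : Type u) [CommRing R] [CommRing U] [Algebra R U] : Type u :=
  U ⧸ LinearMap.range (Algebra.linearMap R U)

/-- A linear topology on a commutative ring `R`, given by its filter of open ideals. -/
structure LinearTopologyOn (R : Type u) [CommRing R] : Type u where
  sets : Set (Ideal R)
  top_mem : (⊤ : Ideal R) ∈ sets
  mem_of_le : ∀ {I J : Ideal R}, I ∈ sets → I ≤ J → J ∈ sets
  inf_mem : ∀ {I J : Ideal R}, I ∈ sets → J ∈ sets → I ⊓ J ∈ sets

/-- An `R`-module `M` is `H`-discrete if the annihilator of every element is open. -/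
def LinearTopologyOn.IsDiscrete {R : Type u} [CommRing R] (H : LinearTopologyOn R)
    (M : Type u) [AddCommGroup M] [Module R M] : Prop :=
  ∀ x : M, Ideal.torsionOf R M x ∈ H.sets

/-- `R` is `H`-h-local: every open ideal is contained in only finitely many maximal ideals,
and every open prime ideal is contained in only one maximal ideal. -/
def LinearTopologyOn.IsHLocal {R : Type u} [CommRing R] (H : LinearTopologyOn R) : Prop :=
  (∀ J ∈ H.sets, {m : Ideal R | m.IsMaximal ∧ J ≤ m}.Finite) ∧
  (∀ p ∈ H.sets, p.IsPrime →
    ∀ m n : Ideal R, m.IsMaximal → n.IsMaximal → p ≤ m → p ≤ n → m = n)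

/-- Over `S`, `M` admits a resolution of length `n` by finitely generated projectives. -/
def FGProjDimLE (S : Type u) [CommRing S] :
    ℕ → ∀ (M : Type u) [AddCommGroup M] [Module S M], Prop
  | 0, M, iA, iM =>
      letI := iA; letI := iM
      Module.Finite S M ∧ Module.Projective S M
  | n + 1, M, iA, iM =>
      letI := iA; letI := iM
      ∃ (k : ℕ) (f : (Fin k → S) →ₗ[S] M),
        Function.Surjective f ∧ FGProjDimLE S n ↥(LinearMap.ker f)

section TensorComparison

open TensorProduct

variable {R : Type*} [CommRing R] {J : Ideal R}
  {S F M : Type*} [AddCommGroup S] [Module R S] [AddCommGroup F] [Module R F]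
  [AddCommGroup M] [Module R M]
  {A N I D B : Type*} [AddCommGroup A] [Module R A] [AddCommGroup N] [Module R N]
  [AddCommGroup I] [Module R I] [AddCommGroup D] [Module R D] [AddCommGroup B] [Module R B]

theorem rTensor_injective_of_one_mem_smul {f : S →ₗ[R] F}
    (hf : ∀ j ∈ J, ∃ k : F →ₗ[R] S, k ∘ₗ f = j • LinearMap.id)
    (hA : (1 : Module.End R A) ∈ J • (⊤ : Submodule R (Module.End R A))) :
    Function.Injective (f.rTensor A) := by
  rw [injective_iff_map_eq_zero]
  intro t ht
  have key : ∀ φ ∈ J • (⊤ : Submodule R (Module.End R A)), LinearMap.lTensor S φ t = 0 := by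
    intro φ hφ
    induction hφ using Submodule.smul_induction_on' with
    | smul j hj φ _ =>
      obtain ⟨k, hk⟩ := hf j hj
      have : j • LinearMap.lTensor S φ = TensorProduct.map k φ ∘ₗ f.rTensor A := by
        ext s a
        have := LinearMap.congr_fun hk s
        simp only [LinearMap.comp_apply, LinearMap.smul_apply, LinearMap.id_apply] at this
        simp [this, TensorProduct.smul_tmul']
      rw [LinearMap.lTensor_smul, this, LinearMap.comp_apply, ht, map_zero]
    | add φ _ ψ _ h₁ h₂ => rw [LinearMap.lTensor_add, LinearMap.add_apply, h₁, h₂, add_zero]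
  simpa [Module.End.one_eq_id] using key 1 hA

theorem rTensor_surjective_of_one_mem_smul {f : S →ₗ[R] F}
    (hf : ∀ j ∈ J, ∃ k : F →ₗ[R] S, f ∘ₗ k = j • LinearMap.id)
    (hA : (1 : Module.End R A) ∈ J • (⊤ : Submodule R (Module.End R A))) :
    Function.Surjective (f.rTensor A) := by
  intro t
  have key : ∀ φ ∈ J • (⊤ : Submodule R (Module.End R A)),
      LinearMap.lTensor F φ t ∈ LinearMap.range (f.rTensor A) := by
    intro φ hφ
    induction hφ using Submodule.smul_induction_on' with
    | smul j hj φ _ =>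
      obtain ⟨k, hk⟩ := hf j hj
      have : j • LinearMap.lTensor F φ = f.rTensor A ∘ₗ TensorProduct.map k φ := by
        ext s a
        have := LinearMap.congr_fun hk s
        simp only [LinearMap.comp_apply, LinearMap.smul_apply, LinearMap.id_apply] at this
        simp [this, TensorProduct.smul_tmul']
      rw [LinearMap.lTensor_smul, this]
      exact ⟨_, rfl⟩
    | add φ _ ψ _ h₁ h₂ =>
      rw [LinearMap.lTensor_add]
      exact add_mem h₁ h₂
  simpa [Module.End.one_eq_id] using key 1 hA

theorem lTensor_injective_of_factors_through_projective [Module.Projective R F]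
    {S' F' : Type*} [AddCommGroup S'] [Module R S'] [AddCommGroup F'] [Module R F']
    [Module.Flat R F'] {i : S' →ₗ[R] F'} {p : F' →ₗ[R] S} (hi : Function.Injective i)
    (hip : Function.Exact i p) (hp : Function.Surjective p) {f : S →ₗ[R] F} (hf : ∀ j ∈ J, ∃ k : F →ₗ[R] S, k ∘ₗ f = j • LinearMap.id)
    {v : I →ₗ[R] D} {w : D →ₗ[R] B} (hv : Function.Injective v) (hvw : Function.Exact v w)
    (hw : Function.Surjective w)
    (hB : (1 : Module.End R B) ∈ J • (⊤ : Submodule R (Module.End R B))) :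
    Function.Injective (v.lTensor S) := by
  have hik : ∀ j ∈ J, ∃ k : F' →ₗ[R] S', k ∘ₗ i = j • LinearMap.id := by
    intro j hj
    obtain ⟨k, hk⟩ := hf j hj
    obtain ⟨l, hl⟩ := Module.projective_lifting_property p k hp
    let e := LinearEquiv.ofInjective i hi
    refine ⟨e.symm.toLinearMap ∘ₗ (j • LinearMap.id - l ∘ₗ f ∘ₗ p).codRestrict
      (LinearMap.range i) fun x => (hip _).1 ?_, LinearMap.ext fun x => hi ?_⟩
    · refine (congrArg Subtype.val (e.apply_symm_apply _)).trans ?_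
      change j • i x - l (f (p (i x))) = i (j • x)
      rw [hip.apply_apply_eq_zero, map_zero, map_zero, sub_zero, map_smul]
    · have h₁ := LinearMap.congr_fun hk (p x)
      have h₂ := LinearMap.congr_fun hl (f (p x))
      simp only [LinearMap.comp_apply, LinearMap.smul_apply, LinearMap.id_apply] at h₁ h₂
      simp [h₂, h₁]
  have hiB := rTensor_injective_of_one_mem_smul hik hB
  rw [injective_iff_map_eq_zero]
  intro x hx
  obtain ⟨y, rfl⟩ := LinearMap.rTensor_surjective I hp x
  have hy : p.rTensor D (v.lTensor _ y) = 0 := by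
    rw [← hx, ← LinearMap.comp_apply, ← LinearMap.comp_apply, LinearMap.rTensor_comp_lTensor,
      LinearMap.lTensor_comp_rTensor]
  obtain ⟨t, ht⟩ := (rTensor_exact D hip hp _).1 hy
  have htB : w.lTensor _ t = 0 := by
    apply hiB
    have : i.rTensor B (w.lTensor _ t) = w.lTensor _ (i.rTensor D t) := by
      rw [← LinearMap.comp_apply, ← LinearMap.comp_apply, LinearMap.rTensor_comp_lTensor,
        LinearMap.lTensor_comp_rTensor]
    rw [this, ht, map_zero]
    exact (lTensor_exact _ hvw hw _).2 ⟨y, rfl⟩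
  obtain ⟨t', rfl⟩ := (lTensor_exact _ hvw hw _).1 htB
  have : y = i.rTensor I t' := by
    apply Module.Flat.lTensor_preserves_injective_linearMap (M := F') v hv
    rw [← ht, ← LinearMap.comp_apply, ← LinearMap.comp_apply, LinearMap.rTensor_comp_lTensor,
        LinearMap.lTensor_comp_rTensor]
  rw [this]
  exact (rTensor_exact I hip hp _).2 ⟨t', rfl⟩

/-- The map induced on kernels of `f ⊗ -` by a linear map. -/
noncomputable def kerRTensorMap (f : S →ₗ[R] F) (v : N →ₗ[R] D) :
    LinearMap.ker (f.rTensor N) →ₗ[R] LinearMap.ker (f.rTensor D) :=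
  (v.lTensor S).restrict fun x hx => by
    rw [LinearMap.mem_ker] at hx ⊢
    rw [← LinearMap.comp_apply, LinearMap.rTensor_comp_lTensor, ← LinearMap.lTensor_comp_rTensor,
      LinearMap.comp_apply, hx, map_zero]

theorem kerRTensorMap_bijective_of_surjective [Module.Flat R F] {f : S →ₗ[R] F}
    {a : A →ₗ[R] N} {v : N →ₗ[R] I} (ha : Function.Injective a) (hav : Function.Exact a v)
    (hv : Function.Surjective v) (hfA : Function.Bijective (f.rTensor A)) :
    Function.Bijective (kerRTensorMap f v) := by
  have comm_a (x) : f.rTensor N (a.lTensor S x) = a.lTensor F (f.rTensor A x) := by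
    rw [← LinearMap.comp_apply, ← LinearMap.comp_apply, LinearMap.rTensor_comp_lTensor,
      LinearMap.lTensor_comp_rTensor]
  have comm_v (x) : f.rTensor I (v.lTensor S x) = v.lTensor F (f.rTensor N x) := by
    rw [← LinearMap.comp_apply, ← LinearMap.comp_apply, LinearMap.rTensor_comp_lTensor,
      LinearMap.lTensor_comp_rTensor]
  constructor
  · rw [injective_iff_map_eq_zero]
    rintro ⟨t, ht⟩ h
    have h' : v.lTensor S t = 0 := congrArg Subtype.val h
    obtain ⟨x, rfl⟩ := (lTensor_exact S hav hv t).1 h'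
    rw [LinearMap.mem_ker, comm_a] at ht
    have h₁ : f.rTensor A x = 0 :=
      Module.Flat.lTensor_preserves_injective_linearMap (M := F) a ha (by rw [ht, map_zero])
    have h₂ : x = 0 := hfA.1 (by rw [h₁, map_zero])
    simp [h₂]
  · rintro ⟨t, ht⟩
    obtain ⟨t, rfl⟩ := LinearMap.lTensor_surjective S hv t
    rw [LinearMap.mem_ker, comm_v] at ht
    obtain ⟨y, hy⟩ := (lTensor_exact F hav hv _).1 ht
    obtain ⟨x, rfl⟩ := hfA.2 y
    refine ⟨⟨t - a.lTensor S x, ?_⟩, Subtype.ext ?_⟩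
    · rw [LinearMap.mem_ker, map_sub, comm_a, hy, sub_self]
    · change v.lTensor S (t - a.lTensor S x) = v.lTensor S t
      rw [map_sub, (lTensor_exact S hav hv _).2 ⟨x, rfl⟩, sub_zero]

theorem kerRTensorMap_bijective_of_injective [Module.Flat R F] {f : S →ₗ[R] F}
    {v : I →ₗ[R] D} {w : D →ₗ[R] B} (hv : Function.Injective v) (hvw : Function.Exact v w)
    (hw : Function.Surjective w) (hvS : Function.Injective (v.lTensor S))
    (hfB : Function.Injective (f.rTensor B)) :
    Function.Bijective (kerRTensorMap f v) := by
  constructor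
  · intro x y h
    exact Subtype.ext (hvS (congrArg Subtype.val h))
  · rintro ⟨t, ht⟩
    rw [LinearMap.mem_ker] at ht
    have htB : w.lTensor S t = 0 := by
      apply hfB
      rw [← LinearMap.comp_apply, LinearMap.rTensor_comp_lTensor,
        ← LinearMap.lTensor_comp_rTensor, LinearMap.comp_apply, ht, map_zero, map_zero]
    obtain ⟨x, rfl⟩ := (lTensor_exact S hvw hw t).1 htB
    refine ⟨⟨x, ?_⟩, rfl⟩
    rw [LinearMap.mem_ker]
    apply Module.Flat.lTensor_preserves_injective_linearMap (M := F) v hv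
    rw [← LinearMap.comp_apply, LinearMap.lTensor_comp_rTensor,
        ← LinearMap.rTensor_comp_lTensor, LinearMap.comp_apply, ht, map_zero]

/-- A map whose kernel and cokernel are `J`-contractible, in the sense that their identity maps
lie in `J • End`, induces an isomorphism on the kernels of `f ⊗ -`, when `f` is the inclusion of
the kernel of a map from a projective module to a module annihilated by `J`. -/
theorem nonempty_kerRTensor_equiv [Module.Projective R F] {f : S →ₗ[R] F}
    (hf : Function.Injective f)
    (hJ : ∀ j ∈ J, ∃ k : F →ₗ[R] S, f ∘ₗ k = j • LinearMap.id)
    {a : A →ₗ[R] N} {d : N →ₗ[R] D} {w : D →ₗ[R] B} (ha : Function.Injective a)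
    (had : Function.Exact a d) (hdw : Function.Exact d w) (hw : Function.Surjective w)
    (hA : (1 : Module.End R A) ∈ J • (⊤ : Submodule R (Module.End R A)))
    (hB : (1 : Module.End R B) ∈ J • (⊤ : Submodule R (Module.End R B))) :
    Nonempty (LinearMap.ker (f.rTensor N) ≃ₗ[R] LinearMap.ker (f.rTensor D)) := by
  have hJ' : ∀ j ∈ J, ∃ k : F →ₗ[R] S, k ∘ₗ f = j • LinearMap.id := by
    intro j hj
    obtain ⟨k, hk⟩ := hJ j hj
    refine ⟨k, LinearMap.ext fun x => hf ?_⟩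
    simpa using LinearMap.congr_fun hk (f x)
  have hIw : Function.Exact (LinearMap.range d).subtype w := fun x => by
    rw [hdw x]; simp
  have hIv : Function.Exact a d.rangeRestrict := fun x => by
    rw [← had x, ← Subtype.coe_inj]; rfl
  exact ⟨(LinearEquiv.ofBijective _ (kerRTensorMap_bijective_of_surjective ha hIv
      d.surjective_rangeRestrict ⟨rTensor_injective_of_one_mem_smul hJ' hA,
        rTensor_surjective_of_one_mem_smul hJ hA⟩)).trans
    (LinearEquiv.ofBijective _ (kerRTensorMap_bijective_of_injective
      (LinearMap.range d).injective_subtype hIw hw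
      (lTensor_injective_of_factors_through_projective
        (Submodule.injective_subtype (LinearMap.ker (Finsupp.linearCombination R (id : S → S))))
        (LinearMap.exact_subtype_ker_map _) (Finsupp.linearCombination_id_surjective R S) hJ'
        (LinearMap.range d).injective_subtype hIw hw hB)
      (rTensor_injective_of_one_mem_smul hJ' hB)))⟩

end TensorComparison

section ExtComparison

variable {R : Type*} [CommRing R] {J : Ideal R}

theorem one_mem_smul_end_hom {U N : Type*} [AddCommGroup U] [Module R U]
    [AddCommGroup N] [Module R N]
    (hU : (1 : Module.End R U) ∈ J • (⊤ : Submodule R (Module.End R U))) :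
    (1 : Module.End R (U →ₗ[R] N)) ∈ J • (⊤ : Submodule R (Module.End R (U →ₗ[R] N))) := by
  let L : Module.End R U →ₗ[R] Module.End R (U →ₗ[R] N) := (LinearMap.llcomp R U U N).flip
  have h₁ : L 1 = 1 := by ext; rfl
  rw [← h₁]
  exact (Submodule.map_smul'' J ⊤ L).le.trans (Submodule.smul_mono le_rfl le_top)
    (Submodule.mem_map_of_mem hU)

/-- If the identity of `V` lies in `J • End V`, then so does the identity of `Ext¹(V, N)`, computed
from any projective presentation of `V`. -/
theorem one_mem_smul_end_quotient_range_lcomp {S F V N : Type*} [AddCommGroup S] [Module R S]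
    [AddCommGroup F] [Module R F] [AddCommGroup V] [Module R V] [AddCommGroup N] [Module R N]
    [Module.Projective R F] {f : S →ₗ[R] F} {p : F →ₗ[R] V} (hf : Function.Injective f)
    (hfp : Function.Exact f p) (hp : Function.Surjective p)
    (hV : (1 : Module.End R V) ∈ J • (⊤ : Submodule R (Module.End R V))) :
    (1 : Module.End R ((S →ₗ[R] N) ⧸ LinearMap.range (LinearMap.lcomp R N f))) ∈
      J • (⊤ : Submodule R
        (Module.End R ((S →ₗ[R] N) ⧸ LinearMap.range (LinearMap.lcomp R N f)))) := by
  let Q := LinearMap.range (LinearMap.lcomp R N f)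
  have lift {g : F →ₗ[R] F} (hg : p ∘ₗ g ∘ₗ f = 0) : ∃ s : S →ₗ[R] S, f ∘ₗ s = g ∘ₗ f := by
    let e := LinearEquiv.ofInjective f hf
    refine ⟨e.symm.toLinearMap ∘ₗ (g ∘ₗ f).codRestrict (LinearMap.range f) fun x =>
      (hfp _).1 (LinearMap.congr_fun hg x), LinearMap.ext fun x => ?_⟩
    exact congrArg Subtype.val (e.apply_symm_apply _)
  have key : ∀ φ ∈ J • (⊤ : Submodule R (Module.End R V)),
      ∃ (g : F →ₗ[R] F) (s : S →ₗ[R] S) (ψ : Module.End R ((S →ₗ[R] N) ⧸ Q)),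
        p ∘ₗ g = φ ∘ₗ p ∧ f ∘ₗ s = g ∘ₗ f ∧
        ψ ∈ J • (⊤ : Submodule R (Module.End R ((S →ₗ[R] N) ⧸ Q))) ∧
        ∀ h, ψ (Q.mkQ h) = Q.mkQ (h ∘ₗ s) := by
    intro φ hφ
    induction hφ using Submodule.smul_induction_on' with
    | smul j hj φ _ =>
      obtain ⟨g, hg⟩ := Module.projective_lifting_property p (φ ∘ₗ p) hp
      obtain ⟨s, hs⟩ := lift (g := g) (by
        rw [← LinearMap.comp_assoc, hg, LinearMap.comp_assoc, hfp.linearMap_comp_eq_zero,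
          LinearMap.comp_zero])
      refine ⟨j • g, j • s, j • Q.mapQ Q (LinearMap.lcomp R N s) ?_, ?_, ?_,
        Submodule.smul_mem_smul hj trivial, ?_⟩
      · rintro _ ⟨h, rfl⟩
        refine ⟨h ∘ₗ g, ?_⟩
        change (h ∘ₗ g) ∘ₗ f = (h ∘ₗ f) ∘ₗ s
        rw [LinearMap.comp_assoc, LinearMap.comp_assoc, hs]
      · rw [LinearMap.comp_smul, hg, LinearMap.smul_comp]
      · rw [LinearMap.comp_smul, hs, LinearMap.smul_comp]
      · intro h
        rw [LinearMap.comp_smul, map_smul]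
        rfl
    | add φ _ φ' _ h₁ h₂ =>
      obtain ⟨g, s, ψ, hg, hs, hψ, h⟩ := h₁
      obtain ⟨g', s', ψ', hg', hs', hψ', h'⟩ := h₂
      refine ⟨g + g', s + s', ψ + ψ', ?_, ?_, add_mem hψ hψ', fun x => ?_⟩
      · rw [LinearMap.comp_add, LinearMap.add_comp, hg, hg']
      · rw [LinearMap.comp_add, LinearMap.add_comp, hs, hs']
      · rw [LinearMap.comp_add, map_add, LinearMap.add_apply, h, h']
  obtain ⟨g, s, ψ, hg, hs, hψ, h⟩ := key 1 hV
  have hψ₁ : ψ = 1 := by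
    let e := LinearEquiv.ofInjective f hf
    let k : F →ₗ[R] S := e.symm.toLinearMap ∘ₗ
      (g - LinearMap.id).codRestrict (LinearMap.range f) fun x => (hfp _).1 (by
        have := LinearMap.congr_fun hg x
        simp only [LinearMap.comp_apply, Module.End.one_apply] at this
        simp [this])
    have hk (x : F) : f (k x) = g x - x := congrArg Subtype.val (e.apply_symm_apply _)
    refine LinearMap.ext fun x => ?_
    obtain ⟨x, rfl⟩ := Q.mkQ_surjective x
    rw [h, Module.End.one_apply, ← sub_eq_zero, ← map_sub, Submodule.mkQ_apply,
      Submodule.Quotient.mk_eq_zero]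
    refine ⟨x ∘ₗ k, LinearMap.ext fun y => ?_⟩
    have : k (f y) = s y - y := hf (by
      have := LinearMap.congr_fun hs y
      simp only [LinearMap.comp_apply] at this
      rw [hk, map_sub, this])
    simp [this]
  rw [← hψ₁]
  exact hψ

/-- Four-term part of the long exact sequence obtained by applying `Hom(-, N)` to
`0 → R → U → K → 0`, where `S → F → K` is a projective presentation of `K`. The last term
`Ext¹(U, N)` is computed from an associated projective presentation `S → F × R → U` of `U`. -/
theorem exists_exact_eval_quotient_range_lcomp {U K N F S : Type*} [AddCommGroup U] [Module R U]
    [AddCommGroup K] [Module R K] [AddCommGroup N] [Module R N] [AddCommGroup F] [Module R F]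
    [AddCommGroup S] [Module R S] [Module.Projective R F]
    {i : R →ₗ[R] U} {q : U →ₗ[R] K} (hi : Function.Injective i) (hiq : Function.Exact i q)
    (hq : Function.Surjective q) {f : S →ₗ[R] F} {p : F →ₗ[R] K} (hf : Function.Injective f)
    (hfp : Function.Exact f p) (hp : Function.Surjective p)
    (hU : (1 : Module.End R U) ∈ J • (⊤ : Submodule R (Module.End R U))) :
    ∃ (d : N →ₗ[R] (S →ₗ[R] N) ⧸ LinearMap.range (LinearMap.lcomp R N f)) (f' : S →ₗ[R] F × R)
      (w : ((S →ₗ[R] N) ⧸ LinearMap.range (LinearMap.lcomp R N f)) →ₗ[R]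
        (S →ₗ[R] N) ⧸ LinearMap.range (LinearMap.lcomp R N f')),
      Function.Exact (LinearMap.applyₗ (i 1) : (U →ₗ[R] N) →ₗ[R] N) d ∧
      Function.Exact d w ∧ Function.Surjective w ∧
      (1 : Module.End R ((S →ₗ[R] N) ⧸ LinearMap.range (LinearMap.lcomp R N f'))) ∈
        J • (⊤ : Submodule R
          (Module.End R ((S →ₗ[R] N) ⧸ LinearMap.range (LinearMap.lcomp R N f')))) := by
  obtain ⟨g, hg⟩ := Module.projective_lifting_property q p hq
  have hg' (x : F) : q (g x) = p x := LinearMap.congr_fun hg x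
  let e := LinearEquiv.ofInjective i hi
  let c : S →ₗ[R] R := e.symm.toLinearMap ∘ₗ
    (g ∘ₗ f).codRestrict (LinearMap.range i) fun x => (hiq _).1 (by
      rw [LinearMap.comp_apply, hg', hfp.apply_apply_eq_zero])
  have hc (x : S) : i (c x) = g (f x) := congrArg Subtype.val (e.apply_symm_apply _)
  let f' : S →ₗ[R] F × R := f.prod (-c)
  let p' : F × R →ₗ[R] U := g.coprod i
  have hf' : Function.Injective f' := fun x y h => hf (congrArg Prod.fst h)
  have hfp' : Function.Exact f' p' := by
    rintro ⟨x, r⟩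
    constructor
    · intro h
      replace h : g x + i r = 0 := h
      obtain ⟨s, rfl⟩ := (hfp x).1 (by
        rw [← hg', eq_neg_of_add_eq_zero_left h, map_neg, hiq.apply_apply_eq_zero, neg_zero])
      refine ⟨s, Prod.ext rfl (hi ?_)⟩
      change i (-c s) = i r
      rw [map_neg, hc, eq_neg_of_add_eq_zero_right h]
    · rintro ⟨s, hs⟩
      rw [← hs]
      change g (f s) + i (-c s) = 0
      rw [map_neg, hc, add_neg_cancel]
  have hp' : Function.Surjective p' := by
    intro x
    obtain ⟨y, hy⟩ := hp (q x)
    obtain ⟨r, hr⟩ := (hiq (x - g y)).1 (by rw [map_sub, hg', hy, sub_self])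
    refine ⟨(y, r), ?_⟩
    change g y + i r = x
    rw [hr, add_sub_cancel]
  let Q := LinearMap.range (LinearMap.lcomp R N f)
  let Q' := LinearMap.range (LinearMap.lcomp R N f')
  let d : N →ₗ[R] (S →ₗ[R] N) ⧸ Q :=
    Q.mkQ ∘ₗ LinearMap.lcomp R N c ∘ₗ (LinearMap.ringLmapEquivSelf R R N).symm.toLinearMap
  have hd (n : N) : d n = Q.mkQ (LinearMap.toSpanSingleton R N n ∘ₗ c) := rfl
  let w : ((S →ₗ[R] N) ⧸ Q) →ₗ[R] (S →ₗ[R] N) ⧸ Q' := Q.mapQ Q' LinearMap.id (by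
    rintro _ ⟨h, rfl⟩
    exact ⟨h ∘ₗ LinearMap.fst R F R, rfl⟩)
  refine ⟨d, f', w, ?_, ?_, ?_, one_mem_smul_end_quotient_range_lcomp hf' hfp' hp' hU⟩
  · intro n
    rw [hd, Submodule.mkQ_apply, Submodule.Quotient.mk_eq_zero]
    constructor
    · rintro ⟨h, hh⟩
      have hh (s : S) : h (f s) = c s • n := LinearMap.congr_fun hh s
      let k : F × R →ₗ[R] N := h.coprod (LinearMap.toSpanSingleton R N n)
      have hk : LinearMap.ker p' ≤ LinearMap.ker k := by
        intro x hx
        obtain ⟨s, rfl⟩ := (hfp' x).1 hx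
        change h (f s) + (-c s) • n = 0
        rw [hh, neg_smul, add_neg_cancel]
      let a : U →ₗ[R] N := (LinearMap.ker p').liftQ k hk ∘ₗ
        (p'.quotKerEquivOfSurjective hp').symm.toLinearMap
      have ha (x : F × R) : a (p' x) = k x := by
        have : (p'.quotKerEquivOfSurjective hp').symm (p' x) = (LinearMap.ker p').mkQ x := by
          rw [LinearEquiv.symm_apply_eq]; rfl
        change (LinearMap.ker p').liftQ k hk _ = _
        rw [LinearEquiv.coe_coe, this]
        rfl
      refine ⟨a, ?_⟩
      have h₁ : p' (0, 1) = i 1 := by simp [p']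
      change a (i 1) = n
      rw [← h₁, ha]
      simp [k]
    · rintro ⟨a, rfl⟩
      refine ⟨a ∘ₗ g, LinearMap.ext fun s => ?_⟩
      change a (g (f s)) = c s • a (i 1)
      rw [← hc, ← map_smul, ← map_smul, smul_eq_mul, mul_one]
  · intro y
    obtain ⟨y, rfl⟩ := Q.mkQ_surjective y
    change Q'.mkQ y = 0 ↔ _
    rw [Submodule.mkQ_apply, Submodule.Quotient.mk_eq_zero]
    constructor
    · rintro ⟨h, rfl⟩
      refine ⟨-h (0, 1), ?_⟩
      rw [hd, ← sub_eq_zero, ← map_sub, Submodule.mkQ_apply, Submodule.Quotient.mk_eq_zero]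
      refine ⟨-(h ∘ₗ LinearMap.inl R F R), LinearMap.ext fun s => ?_⟩
      change -h (f s, 0) = c s • (-h (0, 1)) - h (f s, -c s)
      have : ((f s, -c s) : F × R) = (f s, 0) - c s • (0, 1) := by simp
      rw [this, map_sub, map_smul, smul_neg]
      abel
    · rintro ⟨n, hn⟩
      rw [hd, ← sub_eq_zero, ← map_sub, Submodule.mkQ_apply, Submodule.Quotient.mk_eq_zero] at hn
      obtain ⟨h, hh⟩ := hn
      have hh (s : S) : h (f s) = c s • n - y s := LinearMap.congr_fun hh s
      refine ⟨(-h).coprod (-LinearMap.toSpanSingleton R N n), LinearMap.ext fun s => ?_⟩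
      change -h (f s) + -((-c s) • n) = y s
      rw [hh, neg_smul]
      abel
  · intro y
    obtain ⟨y, rfl⟩ := Q'.mkQ_surjective y
    exact ⟨Q.mkQ y, rfl⟩

end ExtComparison

section FlatEpimorphism

open TensorProduct

variable {R : Type u} [CommRing R] {U : Type u} [CommRing U] [Algebra R U]

theorem one_mem_smul_end_of_smul_top_eq_top {J : Ideal R}
    (hJ : J • (⊤ : Submodule R U) = ⊤) :
    (1 : Module.End R U) ∈ J • (⊤ : Submodule R (Module.End R U)) := by
  have h₁ : (LinearMap.mul R U) 1 = 1 := by ext; simp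
  rw [← h₁]
  refine (Submodule.map_smul'' J ⊤ (LinearMap.mul R U)).le.trans
    (Submodule.smul_mono le_rfl le_top) (Submodule.mem_map_of_mem ?_)
  rw [hJ]
  trivial

theorem subsingleton_tensor_cokerAlg
    (hepi : ∀ (S : Type u) [CommRing S] (f g : U →+* S),
      f.comp (algebraMap R U) = g.comp (algebraMap R U) → f = g) :
    Subsingleton (U ⊗[R] cokerAlg R U) := by
  have hcomm (x : U) : (x ⊗ₜ[R] (1 : U)) = (1 : U) ⊗ₜ[R] x := by
    refine RingHom.congr_fun (hepi (U ⊗[R] U)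
      (Algebra.TensorProduct.includeLeft : U →ₐ[R] U ⊗[R] U).toRingHom
      (Algebra.TensorProduct.includeRight : U →ₐ[R] U ⊗[R] U).toRingHom ?_) x
    ext r
    simp
  refine subsingleton_of_forall_eq 0 fun t => ?_
  induction t using TensorProduct.induction_on with
  | zero => rfl
  | add x y hx hy => rw [hx, hy, add_zero]
  | tmul v k =>
    obtain ⟨x, rfl⟩ := Submodule.mkQ_surjective _ k
    have h₁ : v ⊗ₜ[R] x = (v * x) ⊗ₜ[R] (1 : U) := by
      have := congrArg (fun t => (v ⊗ₜ[R] (1 : U)) * t) (hcomm x)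
      simpa using this.symm
    have h₂ := congrArg (LinearMap.lTensor U (LinearMap.range (Algebra.linearMap R U)).mkQ) h₁
    rw [LinearMap.lTensor_tmul, LinearMap.lTensor_tmul] at h₂
    rw [h₂, show (LinearMap.range (Algebra.linearMap R U)).mkQ 1 = 0 from
      (Submodule.Quotient.mk_eq_zero _).2 ⟨1, by simp⟩, tmul_zero]

/-- For a flat ring epimorphism `R → U`, every element of `U/R` is annihilated by an ideal `I`
with `IU = U`. -/
theorem torsionOf_cokerAlg_smul_top [Module.Flat R U]
    (hepi : ∀ (S : Type u) [CommRing S] (f g : U →+* S),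
      f.comp (algebraMap R U) = g.comp (algebraMap R U) → f = g) (k : cokerAlg R U) :
    Ideal.torsionOf R (cokerAlg R U) k • (⊤ : Submodule R U) = ⊤ := by
  have := subsingleton_tensor_cokerAlg hepi
  let I := Ideal.torsionOf R (cokerAlg R U) k
  have hex : Function.Exact I.subtype (LinearMap.toSpanSingleton R (cokerAlg R U) k) :=
    LinearMap.exact_subtype_ker_map _
  have key (t : U ⊗[R] I) :
      TensorProduct.rid R U (LinearMap.lTensor U I.subtype t) ∈ I • (⊤ : Submodule R U) := by
    induction t using TensorProduct.induction_on with
    | zero => simp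
    | add x y hx hy => rw [map_add, map_add]; exact add_mem hx hy
    | tmul x r =>
      rw [LinearMap.lTensor_tmul, TensorProduct.rid_tmul]
      exact Submodule.smul_mem_smul r.2 trivial
  refine eq_top_iff.2 fun x _ => ?_
  obtain ⟨t, ht⟩ := (Module.Flat.lTensor_exact U hex (x ⊗ₜ 1)).1 (Subsingleton.elim _ _)
  simpa [ht] using key t

end FlatEpimorphism

theorem stmt14 (R : Type u) [CommRing R] (G : GabrielTopology R)
    (U : Type u) [CommRing U] [Algebra R U]
    (hinj : Function.Injective (algebraMap R U))
    (hflat : Module.Flat R U)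
    (hepi : ∀ (S : Type u) [CommRing S] (f g : U →+* S),
      f.comp (algebraMap R U) = g.comp (algebraMap R U) → f = g)
    (hGchar : ∀ J : Ideal R, J ∈ G.sets ↔ J • (⊤ : Submodule R U) = ⊤)
    (N : Type u) [AddCommGroup N] [Module R N] (hN : G.IsTorsionFree N)
    (J : Ideal R) (hJ : J ∈ G.sets) :
    Nonempty (tor1 R (R ⧸ J) N ≃ₗ[R] tor1 R (R ⧸ J) (ext1 R (cokerAlg R U) N)) := by
  have hU := one_mem_smul_end_of_smul_top_eq_top ((hGchar J).1 hJ)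
  obtain ⟨d, f', w, had, hdw, hw, hB⟩ := exists_exact_eval_quotient_range_lcomp (N := N)
    (i := Algebra.linearMap R U) (q := (LinearMap.range (Algebra.linearMap R U)).mkQ)
    (p := Finsupp.linearCombination R (id : cokerAlg R U → cokerAlg R U)) hinj
    (LinearMap.exact_map_mkQ_range _) (Submodule.mkQ_surjective _) (Submodule.injective_subtype _)
    (LinearMap.exact_subtype_ker_map _) (Finsupp.linearCombination_id_surjective R _) hU
  refine nonempty_kerRTensor_equiv (J := J) (Submodule.injective_subtype _) (fun j hj => ?_) ?_
    had hdw hw (one_mem_smul_end_hom hU) hB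
  · refine ⟨(j • LinearMap.id).codRestrict _ fun x => ?_, rfl⟩
    rw [LinearMap.mem_ker, LinearMap.smul_apply, map_smul]
    obtain ⟨r, hr⟩ := Ideal.Quotient.mk_surjective
      (Finsupp.linearCombination R (id : R ⧸ J → R ⧸ J) x)
    rw [LinearMap.id_apply, ← hr]
    exact Ideal.Quotient.eq_zero_iff_mem.2 (J.mul_mem_right r hj)
  · rw [injective_iff_map_eq_zero]
    intro a ha
    replace ha : a 1 = 0 := by simpa using ha
    refine LinearMap.ext fun x => hN _ (G.mem_of_le ((hGchar _).2
      (torsionOf_cokerAlg_smul_top hepi (Submodule.Quotient.mk x))) fun r hr => ?_)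
    rw [Ideal.mem_torsionOf_iff, ← Submodule.Quotient.mk_smul,
      Submodule.Quotient.mk_eq_zero] at hr
    obtain ⟨s, hs⟩ := hr
    rw [Ideal.mem_torsionOf_iff, ← map_smul, ← hs, Algebra.linearMap_apply,
      Algebra.algebraMap_eq_smul_one, map_smul, ha, smul_zero]
end

section
/- Let u : R → U be a flat injective ring epimorphism of commutative rings with associated Gabriel topology G and K := U/R, and let 𝔯 := Hom_R(K, K) = End_R(K). Then the finite topology and the G-topology on 𝔯 coincide: every basic open subgroup V_X (the annihilator of a finite subset X of K) equals 𝔯·I for the ideal I = Ann_R(X) ∈ G, and for every J ∈ G the submodule 𝔯·J contains some V_X. -/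
universe u

open scoped TensorProduct

section FlatEpimorphism

variable {R U : Type u} [CommRing R] [CommRing U] [Algebra R U]

theorem cokerAlg_mk_one : (Submodule.Quotient.mk 1 : cokerAlg R U) = 0 :=
  (Submodule.Quotient.mk_eq_zero _).mpr ⟨1, by simp⟩

/-- For a flat epimorphism `R → U`, annihilators of elements of `U/R` generate the unit ideal
of `U`. -/
theorem torsionOf_smul_top_eq_top_of_flat_of_epi (hflat : Module.Flat R U)
    (hepi : ∀ (S : Type u) [CommRing S] (f g : U →+* S),
      f.comp (algebraMap R U) = g.comp (algebraMap R U) → f = g)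
    (x : cokerAlg R U) :
    Ideal.torsionOf R (cokerAlg R U) x • (⊤ : Submodule R U) = ⊤ := by
  obtain ⟨v, rfl⟩ := Submodule.Quotient.mk_surjective _ x
  set A := Ideal.torsionOf R (cokerAlg R U) (Submodule.Quotient.mk v)
  have hswap : (v ⊗ₜ[R] 1 : U ⊗[R] U) = 1 ⊗ₜ v := by
    have h := hepi (U ⊗[R] U) Algebra.TensorProduct.includeLeftRingHom
      (Algebra.TensorProduct.includeRight : U →ₐ[R] U ⊗[R] U).toRingHom (by
        ext r
        simp [Algebra.TensorProduct.algebraMap_apply, Algebra.TensorProduct.tmul_one_eq_one_tmul])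
    simpa using RingHom.congr_fun h v
  let ι : (R ⧸ A) →ₗ[R] cokerAlg R U :=
    A.liftQ (LinearMap.toSpanSingleton R _ (Submodule.Quotient.mk v)) le_rfl
  have hι : Function.Injective ι :=
    LinearMap.ker_eq_bot.mp (Submodule.ker_liftQ_eq_bot _ _ _ le_rfl)
  have hιU := Module.Flat.lTensor_preserves_injective_linearMap (M := U) ι hι
  rw [eq_top_iff]
  rintro w -
  have hw : (w ⊗ₜ[R] (Submodule.Quotient.mk 1 : R ⧸ A) : U ⊗[R] (R ⧸ A)) = 0 := by
    apply hιU
    have hwv : (w ⊗ₜ[R] v : U ⊗[R] U) = (w * v) ⊗ₜ 1 := by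
      simpa using (congrArg (fun t => (w ⊗ₜ[R] 1 : U ⊗[R] U) * t) hswap).symm
    have h := congrArg (LinearMap.lTensor U (Submodule.mkQ _ : U →ₗ[R] cokerAlg R U)) hwv
    simp only [LinearMap.lTensor_tmul, Submodule.mkQ_apply, cokerAlg_mk_one,
      TensorProduct.tmul_zero] at h
    have hι1 : ι (Submodule.Quotient.mk 1) = Submodule.Quotient.mk v :=
      (Submodule.liftQ_apply _ _ _).trans (one_smul R _)
    rw [LinearMap.lTensor_tmul, hι1, h, map_zero]
  have h := congrArg (TensorProduct.tensorQuotEquivQuotSMul U A) hw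
  rw [map_zero] at h
  erw [TensorProduct.tensorQuotEquivQuotSMul_tmul_mk] at h
  simpa using h

/-- An ideal `J` with `JU = U` has a finite family of coefficients expressing `1`. -/
theorem exists_finsupp_sum_smul_eq_one {J : Ideal R} (hJ : J • (⊤ : Submodule R U) = ⊤) :
    ∃ a : U →₀ R, (∀ w, a w ∈ J) ∧ ∑ w ∈ a.support, a w • w = 1 := by
  have h : (1 : U) ∈ J • Submodule.span R (Set.range (id : U → U)) := by
    simp [hJ]
  obtain ⟨a, ha, hsum⟩ := (Submodule.mem_ideal_smul_span_iff_exists_sum _ _ _).mp h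
  exact ⟨a, ha, hsum⟩

/-- If `1 = ∑ a w • w` with coefficients in `J`, then every endomorphism of `U/R` killing the
classes of the `w` lies in `J • End(U/R)`. -/
theorem mem_smul_top_of_forall_mk_eq_zero {J : Ideal R} {a : U →₀ R} (ha : ∀ w, a w ∈ J)
    (hsum : ∑ w ∈ a.support, a w • w = 1) (f : cokerAlg R U →ₗ[R] cokerAlg R U)
    (hf : ∀ w ∈ a.support, f (Submodule.Quotient.mk w) = 0) :
    f ∈ J • (⊤ : Submodule R (cokerAlg R U →ₗ[R] cokerAlg R U)) := by
  have hex : ∀ w ∈ a.support, ∃ g : cokerAlg R U →ₗ[R] cokerAlg R U,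
      ∀ v : U, g (Submodule.Quotient.mk v) = f (Submodule.Quotient.mk (w * v)) := by
    intro w hw
    refine ⟨Submodule.liftQ _ (f ∘ₗ Submodule.mkQ _ ∘ₗ LinearMap.mulLeft R w) ?_, fun _ => rfl⟩
    rintro _ ⟨r, rfl⟩
    have hr : w * algebraMap R U r = r • w := by rw [Algebra.smul_def, mul_comm]
    simp [hr, hf w hw]
  choose! g hg using hex
  have hfg : f = ∑ w ∈ a.support, a w • g w := by
    refine LinearMap.ext fun x => ?_
    obtain ⟨v, rfl⟩ := Submodule.Quotient.mk_surjective _ x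
    rw [LinearMap.sum_apply]
    calc f (Submodule.Quotient.mk v)
        = f (Submodule.mkQ _ (∑ w ∈ a.support, a w • (w * v))) := by
          simp only [← smul_mul_assoc, ← Finset.sum_mul, hsum, one_mul, Submodule.mkQ_apply]
      _ = _ := by
          rw [map_sum, map_sum]
          refine Finset.sum_congr rfl fun w hw => ?_
          rw [map_smul, map_smul, LinearMap.smul_apply, hg w hw, Submodule.mkQ_apply]
  rw [hfg]
  exact Submodule.sum_mem _ fun w _ => Submodule.smul_mem_smul (ha w) trivial

/-- If `JU = U`, every endomorphism of `U/R` agrees with the multiplication by some `r : R` on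
the `J`-torsion of `U/R`. -/
theorem exists_forall_apply_eq_smul {J : Ideal R} (hJ : J • (⊤ : Submodule R U) = ⊤)
    (f : cokerAlg R U →ₗ[R] cokerAlg R U) :
    ∃ r : R, ∀ x : cokerAlg R U, J ≤ Ideal.torsionOf R _ x → f x = r • x := by
  obtain ⟨a, ha, hsum⟩ := exists_finsupp_sum_smul_eq_one hJ
  choose c hc using fun w : U =>
    Submodule.Quotient.mk_surjective _ (f (Submodule.Quotient.mk w))
  have hker : (Submodule.Quotient.mk (∑ w ∈ a.support, a w • c w) : cokerAlg R U) = 0 := by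
    rw [← Submodule.mkQ_apply, map_sum]
    simp_rw [map_smul, Submodule.mkQ_apply, hc, ← map_smul, ← Submodule.Quotient.mk_smul]
    rw [← map_sum]
    simp_rw [← Submodule.mkQ_apply]
    rw [← map_sum, hsum, Submodule.mkQ_apply, cokerAlg_mk_one, map_zero]
  obtain ⟨r, hr⟩ := (Submodule.Quotient.mk_eq_zero _).mp hker
  refine ⟨r, fun x hx => ?_⟩
  obtain ⟨v, rfl⟩ := Submodule.Quotient.mk_surjective _ x
  have hb : ∀ w, ∃ b : R, algebraMap R U b = a w • v := fun w =>
    (Submodule.Quotient.mk_eq_zero _).mp ((Ideal.mem_torsionOf_iff _ _).mp (hx (ha w)))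
  choose b hb using hb
  have hv : v = ∑ w ∈ a.support, b w • w := by
    simp_rw [Algebra.smul_def, hb, smul_mul_assoc, mul_comm v, ← smul_mul_assoc]
    rw [← Finset.sum_mul, hsum, one_mul]
  have hrv : r • v = ∑ w ∈ a.support, b w • c w := by
    rw [Algebra.linearMap_apply] at hr
    simp_rw [Algebra.smul_def, hb, hr, Finset.sum_mul, smul_mul_assoc, mul_comm v]
  rw [← Submodule.Quotient.mk_smul, hrv]
  conv_lhs => rw [hv]
  simp_rw [← Submodule.mkQ_apply, map_sum, map_smul, Submodule.mkQ_apply, hc]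

end FlatEpimorphism

/-- A Gabriel topology is closed under finite intersections. -/
theorem GabrielTopology.iInf_finset_mem {R : Type u} [CommRing R] (G : GabrielTopology R)
    {α : Type*} (s : Finset α) {I : α → Ideal R} (hI : ∀ x ∈ s, I x ∈ G.sets) :
    (⨅ x ∈ s, I x) ∈ G.sets := by
  rw [← Finset.inf_eq_iInf]
  exact Finset.inf_induction G.top_mem (fun _ h _ h' => G.inf_mem h h') hI

theorem stmt15 (R : Type u) [CommRing R] (G : GabrielTopology R)
    (U : Type u) [CommRing U] [Algebra R U]
    (hinj : Function.Injective (algebraMap R U))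
    (hflat : Module.Flat R U)
    (hepi : ∀ (S : Type u) [CommRing S] (f g : U →+* S),
      f.comp (algebraMap R U) = g.comp (algebraMap R U) → f = g)
    (hGchar : ∀ J : Ideal R, J ∈ G.sets ↔ J • (⊤ : Submodule R U) = ⊤) :
    (∀ X : Finset (cokerAlg R U),
      (⨅ x ∈ X, Ideal.torsionOf R (cokerAlg R U) x) ∈ G.sets ∧
      {f : cokerAlg R U →ₗ[R] cokerAlg R U | ∀ x ∈ X, f x = 0} =
        (((⨅ x ∈ X, Ideal.torsionOf R (cokerAlg R U) x) •
          (⊤ : Submodule R (cokerAlg R U →ₗ[R] cokerAlg R U)) :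
            Submodule R (cokerAlg R U →ₗ[R] cokerAlg R U)) : Set _)) ∧
    (∀ J ∈ G.sets, ∃ X : Finset (cokerAlg R U),
      ∀ f : cokerAlg R U →ₗ[R] cokerAlg R U, (∀ x ∈ X, f x = 0) →
        f ∈ J • (⊤ : Submodule R (cokerAlg R U →ₗ[R] cokerAlg R U))) := by
  classical
  have hG : ∀ X : Finset (cokerAlg R U),
      (⨅ x ∈ X, Ideal.torsionOf R (cokerAlg R U) x) ∈ G.sets := fun X =>
    G.iInf_finset_mem X fun x _ =>
      (hGchar _).mpr (torsionOf_smul_top_eq_top_of_flat_of_epi hflat hepi x)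
  refine ⟨fun X => ⟨hG X, Set.Subset.antisymm (fun f hf => ?_) fun f hf x hx => ?_⟩,
    fun J hJ => ?_⟩
  · obtain ⟨a, ha, hsum⟩ := exists_finsupp_sum_smul_eq_one ((hGchar _).mp (hG X))
    obtain ⟨r, hr⟩ := exists_forall_apply_eq_smul
      ((hGchar _).mp (hG (X ∪ a.support.image Submodule.Quotient.mk))) f
    have hr' : ∀ x ∈ X ∪ a.support.image Submodule.Quotient.mk, f x = r • x := fun x hx =>
      hr x (iInf₂_le x hx)
    have hrI : r ∈ ⨅ x ∈ X, Ideal.torsionOf R (cokerAlg R U) x := by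
      simp only [Submodule.mem_iInf, Ideal.mem_torsionOf_iff]
      intro x hx
      rw [← hr' x (Finset.mem_union_left _ hx), hf x hx]
    have hsub := mem_smul_top_of_forall_mk_eq_zero ha hsum (f - r • LinearMap.id)
      fun w hw => by
        simp [hr' _ (Finset.mem_union_right _ (Finset.mem_image_of_mem _ hw))]
    have hadd := Submodule.add_mem _ hsub
      (Submodule.smul_mem_smul hrI (Submodule.mem_top (x := LinearMap.id)))
    rwa [sub_add_cancel] at hadd
  · refine Submodule.smul_induction_on hf (fun r hr g _ => ?_) fun g h hg hh => ?_
    · have hrx := (Ideal.mem_torsionOf_iff _ _).mp 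
        ((iInf₂_le x hx : _ ≤ Ideal.torsionOf R (cokerAlg R U) x) hr)
      rw [LinearMap.smul_apply, ← map_smul, hrx, map_zero]
    · rw [LinearMap.add_apply, hg, hh, add_zero]
  · obtain ⟨a, ha, hsum⟩ := exists_finsupp_sum_smul_eq_one ((hGchar J).mp hJ)
    exact ⟨a.support.image Submodule.Quotient.mk, fun f hf =>
      mem_smul_top_of_forall_mk_eq_zero ha hsum f fun w hw =>
        hf _ (Finset.mem_image_of_mem _ hw)⟩
end

section
/- Let H be a linear topology on a commutative ring R. If R/J is a perfect ring for every open ideal J ∈ H, then R is H-h-nil: every J ∈ H is contained in only finitely many maximal ideals of R, and every prime ideal of R belonging to H is maximal. -/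
universe u

open scoped DirectSum

/-- For every sequence `a` there is a module `M` generated by a sequence `z` subject only to the
relations `z n = a n • z (n + 1)`, namely the colimit of `S → S → ⋯` along the multiplications
by the `a n`. -/
theorem exists_colimit_of_mul_sequence {S : Type u} [CommRing S] (a : ℕ → S) :
    ∃ (M : Type u) (_ : AddCommGroup M) (_ : Module S M) (z : ℕ → M),
      (∀ n m, n ≤ m → z n = (∏ k ∈ Finset.Ico n m, a k) • z m) ∧
      (∀ x, ∃ n, ∃ r : S, x = r • z n) ∧
      (∀ n (r : S), r • z n = 0 → ∃ m, n ≤ m ∧ r * ∏ k ∈ Finset.Ico n m, a k = 0) := by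
  let f : ∀ i j : ℕ, i ≤ j → S →ₗ[S] S := fun i j _ =>
    LinearMap.mulLeft S (∏ k ∈ Finset.Ico i j, a k)
  have : DirectedSystem (fun _ : ℕ => S) (f · · ·) :=
    { map_self := fun i x => by simp [f]
      map_map := fun i j k hij hjk x => by
        simp only [f, LinearMap.mulLeft_apply]
        rw [← Finset.prod_Ico_consecutive a hij hjk]
        ring }
  have of_eq (n : ℕ) (r : S) : Module.DirectLimit.of S ℕ (fun _ => S) f n r =
      r • Module.DirectLimit.of S ℕ (fun _ => S) f n 1 := by
    rw [← map_smul, smul_eq_mul, mul_one]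
  refine ⟨Module.DirectLimit (fun _ : ℕ => S) f, inferInstance, inferInstance,
    fun n => Module.DirectLimit.of S ℕ (fun _ => S) f n 1, ?_, ?_, ?_⟩
  · intro n m hnm
    beta_reduce
    rw [← of_eq, ← Module.DirectLimit.of_f (hij := hnm)]
    simp [f]
  · intro x
    obtain ⟨n, r, rfl⟩ := Module.DirectLimit.exists_of x
    exact ⟨n, r, of_eq n r⟩
  · intro n r h
    rw [← of_eq] at h
    obtain ⟨m, hm, h⟩ := Module.DirectLimit.of.zero_exact h
    exact ⟨m, hm, by simpa [f, mul_comm] using h⟩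

/-- A perfect ring has no strictly descending sequence of principal ideals: the partial products of
any sequence generate ideals that do not shrink at every step. -/
theorem IsPerfectRing.exists_prod_range_dvd {S : Type u} [CommRing S] (hS : IsPerfectRing S)
    (a : ℕ → S) : ∃ n, ∏ k ∈ Finset.range (n + 1), a k ∣ ∏ k ∈ Finset.range n, a k := by
  obtain ⟨M, _, _, z, hz, hgen, hrel⟩ := exists_colimit_of_mul_sequence a
  have common {ι : Type u} (s : Finset ι) (x : ι → M) :
      ∃ n, ∃ r : ι → S, ∀ i ∈ s, x i = r i • z n := by
    choose m b hb using fun i => hgen (x i)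
    refine ⟨s.sup m, fun i => b i * ∏ k ∈ Finset.Ico (m i) (s.sup m), a k, fun i hi => ?_⟩
    rw [mul_smul, ← hz _ _ (Finset.le_sup hi), ← hb]
  have flat : Module.Flat S M := by
    refine Module.Flat.of_forall_isTrivialRelation fun {l c x} h => ?_
    obtain ⟨n, r, hr⟩ := common Finset.univ (fun i : ULift.{u} (Fin l) => x i.down)
    replace hr : ∀ i, x i = r ⟨i⟩ • z n := fun i => hr ⟨i⟩ (Finset.mem_univ _)
    have h0 : (∑ i, c i * r ⟨i⟩) • z n = 0 := by
      rw [← h, Finset.sum_smul]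
      exact Finset.sum_congr rfl fun i _ => by rw [hr, mul_smul]
    obtain ⟨m, hnm, hm⟩ := hrel n _ h0
    refine ⟨1, fun i _ => r ⟨i⟩ * ∏ k ∈ Finset.Ico n m, a k, fun _ => z m, fun i => ?_, fun _ => ?_⟩
    · simp [mul_smul, ← hz n m hnm, hr]
    · rw [← hm, Finset.sum_mul]
      simp only [mul_assoc]
  obtain ⟨s, hs⟩ := (hS M flat).out
  have coeff_dvd (w : M) (n : ℕ) : ∏ k ∈ Finset.range n, a k ∣ s (z 0) w := by
    rw [hz 0 n n.zero_le, map_smul, Finsupp.smul_apply, ← Finset.range_eq_Ico]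
    exact Dvd.intro _ rfl
  obtain ⟨n, r, hr⟩ := common (s (z 0)).support id
  have h0 : ∑ w ∈ (s (z 0)).support, s (z 0) w • w = z 0 := by
    simpa [Finsupp.linearCombination_apply, Finsupp.sum] using hs (z 0)
  have h1 :
      ((∏ k ∈ Finset.range n, a k) - ∑ w ∈ (s (z 0)).support, s (z 0) w * r w) • z n = 0 := by
    rw [sub_smul, Finset.range_eq_Ico, ← hz 0 n n.zero_le, Finset.sum_smul, sub_eq_zero]
    nth_rewrite 1 [← h0]
    refine Finset.sum_congr rfl fun w hw => ?_
    rw [mul_smul, ← hr w hw, id]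
  obtain ⟨m, hnm, hm⟩ := hrel n _ h1
  refine ⟨m, ?_⟩
  rw [sub_mul, sub_eq_zero, Finset.range_eq_Ico, Finset.prod_Ico_consecutive _ n.zero_le hnm] at hm
  rw [Finset.range_eq_Ico m, hm]
  exact Dvd.dvd.mul_right
    (Finset.dvd_sum fun w _ => (coeff_dvd w (m + 1)).mul_right _) _

/-- In a perfect ring, the relation of being a strict multiple is well founded. -/
theorem IsPerfectRing.wellFounded_strict_dvd {S : Type u} [CommRing S] (hS : IsPerfectRing S) :
    WellFounded fun x y : S => y ∣ x ∧ ¬x ∣ y := by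
  rw [wellFounded_iff_isEmpty_descending_chain]
  refine ⟨fun ⟨b, hb⟩ => ?_⟩
  choose c hc using fun n => (hb n).1
  have hprod (n : ℕ) : b n = b 0 * ∏ k ∈ Finset.range n, c k := by
    induction n with
    | zero => simp
    | succ n ih => rw [Finset.prod_range_succ, ← mul_assoc, ← ih, hc]
  obtain ⟨n, hn⟩ := hS.exists_prod_range_dvd c
  apply (hb n).2
  rw [hprod n, hprod (n + 1)]
  exact mul_dvd_mul_left _ hn

/-- A perfect ring is semilocal. -/
theorem IsPerfectRing.finite_isMaximal {S : Type u} [CommRing S] (hS : IsPerfectRing S) :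
    {m : Ideal S | m.IsMaximal}.Finite := by
  let D (x : S) : Set (Ideal S) := {m | m.IsMaximal ∧ x ∉ m}
  suffices h : ∀ x, (D x).Finite by
    refine (h 1).subset fun m hm => ⟨hm, fun h1 => hm.ne_top ((Ideal.eq_top_iff_one m).2 h1)⟩
  intro x
  induction x using hS.wellFounded_strict_dvd.induction with
  | _ x ih =>
    have ih_mul {y : S} {m : Ideal S} (hm : m ∈ D x) (hy : y ∈ m) : (D (x * y)).Finite :=
      ih _ ⟨Dvd.intro _ rfl, fun h => hm.2 (m.mem_of_dvd h (m.mul_mem_left x hy))⟩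
    by_contra hinf
    obtain ⟨m, hm, n, hn, hmn⟩ := (show (D x).Infinite from hinf).nontrivial
    obtain ⟨b, hb, c, hc, hbc⟩ := Submodule.mem_sup.1
      ((Ideal.eq_top_iff_one _).1 (hm.1.coprime_of_ne hn.1 hmn))
    refine hinf (((ih_mul hm hb).union (ih_mul hn hc)).subset fun p hp => ?_)
    by_contra hmem
    simp only [D, Set.mem_union, Set.mem_ofPred_eq, hp.1, true_and, not_or, not_not] at hmem
    apply hp.2
    have := p.add_mem hmem.1 hmem.2
    rwa [← mul_add, hbc, mul_one] at this

/-- A perfect domain is a field. -/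
theorem IsPerfectRing.isField {S : Type u} [CommRing S] [IsDomain S] (hS : IsPerfectRing S) :
    IsField S := by
  refine ⟨exists_pair_ne S, mul_comm, fun {x} hx => ?_⟩
  obtain ⟨n, y, hy⟩ := hS.exists_prod_range_dvd fun _ => x
  simp only [Finset.prod_const, Finset.card_range, pow_succ, mul_assoc] at hy
  exact ⟨y, (mul_eq_left₀ (pow_ne_zero n hx)).1 hy.symm⟩

theorem stmt16 (R : Type u) [CommRing R] (H : LinearTopologyOn R)
    (h : ∀ J ∈ H.sets, IsPerfectRing (R ⧸ J)) :
    (∀ J ∈ H.sets, {m : Ideal R | m.IsMaximal ∧ J ≤ m}.Finite) ∧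
    (∀ p ∈ H.sets, p.IsPrime → p.IsMaximal) := by
  refine ⟨fun J hJ => ?_, fun p hp _ => Ideal.Quotient.maximal_of_isField p (h p hp).isField⟩
  refine ((h J hJ).finite_isMaximal.image (Ideal.comap (Ideal.Quotient.mk J))).subset ?_
  rintro m ⟨hm, hJm⟩
  have hcomap : Ideal.comap (Ideal.Quotient.mk J) (Ideal.map (Ideal.Quotient.mk J) m) = m := by
    simpa using hJm
  refine ⟨_, ?_, hcomap⟩
  refine (Ideal.map_eq_top_or_isMaximal_of_surjective _
    Ideal.Quotient.mk_surjective hm).resolve_left fun htop => hm.ne_top ?_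
  rw [← hcomap, htop, Ideal.comap_top]
end

section
/- Let H be a linear topology on a commutative ring R such that every prime ideal belonging to H is contained in only one maximal ideal. Then for any two distinct maximal ideals m ≠ n of R and every H-discrete R-module M, one has M ⊗_R R_m ⊗_R R_n = 0, where R_m and R_n denote the localisations of R at m and n. -/
universe u

open scoped DirectSum

/-- If no prime ideal containing `I` lies in both `p` and `q`, then `I` contains a product of an
element outside `p` and an element outside `q`. -/
theorem exists_mul_mem_of_no_common_prime {R : Type*} [CommRing R] (I p q : Ideal R)
    [p.IsPrime] [q.IsPrime]
    (h : ∀ r : Ideal R, r.IsPrime → I ≤ r → r ≤ p → ¬ r ≤ q) :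
    ∃ s ∈ p.primeCompl, ∃ t ∈ q.primeCompl, s * t ∈ I := by
  by_contra! hI
  have hdisj : Disjoint (I : Set R) (p.primeCompl ⊔ q.primeCompl : Submonoid R) := by
    rw [Set.disjoint_left]
    intro x hx hxS
    obtain ⟨s, hs, t, ht, rfl⟩ := Submonoid.mem_sup.mp hxS
    exact hI s hs t ht hx
  obtain ⟨r, hr, hIr, hrS⟩ := Ideal.exists_le_prime_disjoint I _ hdisj
  rw [Set.disjoint_left] at hrS
  refine h r hr hIr (fun x hx => ?_) (fun x hx => ?_)
  · by_contra hxp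
    exact hrS hx ((le_sup_left : p.primeCompl ≤ p.primeCompl ⊔ q.primeCompl) hxp)
  · by_contra hxq
    exact hrS hx ((le_sup_right : q.primeCompl ≤ p.primeCompl ⊔ q.primeCompl) hxq)

/-- Every element of a localization is divisible by every element of the localized monoid. -/
theorem Localization.exists_smul_eq {R : Type*} [CommRing R] {S : Submonoid R} {s : R}
    (hs : s ∈ S) (a : Localization S) : ∃ b : Localization S, s • b = a := by
  refine ⟨Localization.mk 1 ⟨s, hs⟩ * a, ?_⟩
  have h : s • Localization.mk (1 : R) (⟨s, hs⟩ : S) = 1 := by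
    rw [Localization.smul_mk, smul_eq_mul, mul_one]
    exact Localization.mk_self (⟨s, hs⟩ : S)
  rw [← smul_mul_assoc, h, one_mul]

/-- A module all of whose elements are killed by a product `s * t` with `s ∈ S` and `t ∈ T`
vanishes after localizing at both `S` and `T`. -/
theorem subsingleton_tensorProduct_localization_localization {R M : Type*} [CommRing R]
    [AddCommGroup M] [Module R M] (S T : Submonoid R)
    (h : ∀ x : M, ∃ s ∈ S, ∃ t ∈ T, (s * t) • x = 0) :
    Subsingleton (TensorProduct R (TensorProduct R M (Localization S)) (Localization T)) := by
  refine subsingleton_of_forall_eq 0 fun z => ?_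
  induction z using TensorProduct.induction_on with
  | zero => rfl
  | add y z hy hz => rw [hy, hz, add_zero]
  | tmul y b =>
    induction y using TensorProduct.induction_on with
    | zero => exact TensorProduct.zero_tmul _ b
    | add y z hy hz => rw [TensorProduct.add_tmul, hy, hz, add_zero]
    | tmul x a =>
      obtain ⟨s, hs, t, ht, hst⟩ := h x
      obtain ⟨a, rfl⟩ := Localization.exists_smul_eq hs a
      obtain ⟨b, rfl⟩ := Localization.exists_smul_eq ht b
      rw [← TensorProduct.smul_tmul t, TensorProduct.smul_tmul', ← TensorProduct.smul_tmul s,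
        smul_smul, hst, TensorProduct.zero_tmul, TensorProduct.zero_tmul]

theorem stmt17 (R : Type u) [CommRing R] (H : LinearTopologyOn R)
    (hH : ∀ p ∈ H.sets, p.IsPrime →
      ∀ m n : Ideal R, m.IsMaximal → n.IsMaximal → p ≤ m → p ≤ n → m = n)
    (m n : Ideal R) (hm : m.IsMaximal) (hn : n.IsMaximal) (hmn : m ≠ n)
    (M : Type u) [AddCommGroup M] [Module R M] (hM : H.IsDiscrete M) :
    Subsingleton (TensorProduct R
      (TensorProduct R M (Localization (@Ideal.primeCompl R _ m hm.isPrime)))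
      (Localization (@Ideal.primeCompl R _ n hn.isPrime))) := by
  have := hm.isPrime
  have := hn.isPrime
  refine subsingleton_tensorProduct_localization_localization _ _ fun x => ?_
  obtain ⟨s, hs, t, ht, hst⟩ := exists_mul_mem_of_no_common_prime (Ideal.torsionOf R M x) m n
    fun r hr hxr hrm hrn => hmn (hH r (H.mem_of_le (hM x) hxr) hr m n hm hn hrm hrn)
  exact ⟨s, hs, t, ht, (Ideal.mem_torsionOf_iff x _).mp hst⟩
end

section
/- Let H be a linear topology on a commutative ring R. The following are equivalent: (i) R is H-h-local, i.e. every J ∈ H is contained in only finitely many maximal ideals of R and every prime ideal in H is contained in only one maximal ideal; (ii) N ≅ ⨁_{m ∈ Max R} N_m for every H-discrete module N, the sum ranging over all maximal ideals m of R and N_m denoting the localisation of N at m; (iii) N ≅ ⨁_{m ∈ Max R ∩ H} N_m for every H-discrete module N, the sum ranging over the maximal ideals belonging to H. Moreover, these conditions hold whenever R/J is a perfect ring for every J ∈ H. -/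
universe u

open scoped DirectSum

/-- If no prime containing `J` lies in both `m` and `n`, then `J` contains a product of an element
outside `m` and an element outside `n`. -/
theorem exists_mul_mem_of_forall_prime_not_le {R : Type*} [CommRing R] (J m n : Ideal R)
    [m.IsPrime] [n.IsPrime]
    (h : ∀ p : Ideal R, p.IsPrime → J ≤ p → p ≤ m → ¬ p ≤ n) :
    ∃ s ∉ m, ∃ t ∉ n, s * t ∈ J := by
  by_contra! hc
  have hd : Disjoint (J : Set R) ((m.primeCompl ⊔ n.primeCompl : Submonoid R) : Set R) := by
    rw [Set.disjoint_left]
    intro x hx hx'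
    obtain ⟨s, hs, t, ht, rfl⟩ := Submonoid.mem_sup.1 hx'
    exact hc s hs t ht hx
  obtain ⟨p, hp, hJp, hpd⟩ := Ideal.exists_le_prime_disjoint J _ hd
  rw [Set.disjoint_left] at hpd
  refine h p hp hJp (fun x hx => ?_) (fun x hx => ?_)
  · by_contra hxm
    exact hpd hx ((le_sup_left : m.primeCompl ≤ _) hxm)
  · by_contra hxn
    exact hpd hx ((le_sup_right : n.primeCompl ≤ _) hxn)

/-- A linear map into a direct sum, given by pointwise finitely supported components. -/
noncomputable def DirectSum.linearMapOfFiniteSupport {R ι N : Type*} {M : ι → Type*} [CommRing R]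
    [AddCommGroup N] [Module R N] [∀ i, AddCommGroup (M i)] [∀ i, Module R (M i)]
    (g : ∀ i, N →ₗ[R] M i) (hg : ∀ x, {i | g i x ≠ 0}.Finite) : N →ₗ[R] ⨁ i, M i where
  toFun x := letI := Classical.decEq ι; DFinsupp.mk (hg x).toFinset fun i => g i x
  map_add' x y := by
    classical
    refine DFinsupp.ext fun i => ?_
    rw [DirectSum.add_apply]
    simp only [DFinsupp.mk_apply, Set.Finite.mem_toFinset, Set.mem_ofPred_eq]
    grind
  map_smul' r x := by
    classical
    refine DFinsupp.ext fun i => ?_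
    rw [DirectSum.smul_apply]
    simp only [DFinsupp.mk_apply, Set.Finite.mem_toFinset, Set.mem_ofPred_eq, RingHom.id_apply]
    split_ifs <;> simp_all

theorem DirectSum.linearMapOfFiniteSupport_apply {R ι N : Type*} {M : ι → Type*} [CommRing R]
    [AddCommGroup N] [Module R N] [∀ i, AddCommGroup (M i)] [∀ i, Module R (M i)]
    (g : ∀ i, N →ₗ[R] M i) (hg : ∀ x, {i | g i x ≠ 0}.Finite) (x : N) (i : ι) :
    DirectSum.linearMapOfFiniteSupport g hg x i = g i x := by
  classical
  simp only [linearMapOfFiniteSupport, LinearMap.coe_mk, AddHom.coe_mk, DFinsupp.mk_apply,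
    Set.Finite.mem_toFinset, Set.mem_ofPred_eq]
  split_ifs <;> simp_all

/-- Given an element `x` of an `H`-discrete module and `u ∉ m`, some multiple of `x` is equal to
`x / u` locally at `m` and vanishes locally at all other maximal ideals. -/
theorem LinearTopologyOn.IsHLocal.exists_local_lift {R : Type u} [CommRing R]
    {H : LinearTopologyOn R} (hH : H.IsHLocal) {J : Ideal R} (hJ : J ∈ H.sets)
    (m : Ideal R) [hm : m.IsMaximal] {u : R} (hu : u ∉ m) :
    ∃ y : R, (∃ s ∉ m, s * (u * y - 1) ∈ J) ∧
      ∀ n : Ideal R, n.IsMaximal → n ≠ m → ∃ t ∉ n, t * y ∈ J := by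
  have hsep : ∀ n : Ideal R, n.IsMaximal → n ≠ m → ∃ s ∉ m, ∃ t ∉ n, s * t ∈ J := by
    intro n hn hnm
    refine exists_mul_mem_of_forall_prime_not_le J m n fun p hp hJp hpm hpn => hnm ?_
    exact hH.2 p (H.mem_of_le hJ hJp) hp n m hn hm hpn hpm
  have hsep' : ∀ n : Ideal R, ∃ s ∉ m, n.IsMaximal → n ≠ m → ∃ t ∉ n, s * t ∈ J := by
    intro n
    by_cases h : n.IsMaximal ∧ n ≠ m
    · obtain ⟨s, hs, t⟩ := hsep n h.1 h.2
      exact ⟨s, hs, fun _ _ => t⟩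
    · exact ⟨1, m.one_notMem, fun h1 h2 => absurd ⟨h1, h2⟩ h⟩
  choose σ hσm hσ using hsep'
  set s := ∏ n ∈ (hH.1 J hJ).toFinset, σ n with hs
  have hsm : s ∉ m := by
    rw [hs, Ideal.IsPrime.prod_mem_iff]
    push Not
    exact fun n _ => hσm n
  have hst : ∀ n : Ideal R, n.IsMaximal → n ≠ m → ∃ t ∉ n, s * t ∈ J := by
    intro n hn hnm
    by_cases hJn : J ≤ n
    · obtain ⟨t, ht, hst⟩ := hσ n hn hnm
      refine ⟨t, ht, ?_⟩
      obtain ⟨c, hc⟩ := Finset.dvd_prod_of_mem σ ((hH.1 J hJ).mem_toFinset.2 ⟨hn, hJn⟩)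
      rw [hs, hc, mul_right_comm]
      exact J.mul_mem_right _ hst
    · obtain ⟨t, ht, htn⟩ := Set.not_subset.1 hJn
      exact ⟨t, htn, J.mul_mem_left _ ht⟩
  let K : Ideal R :=
    Ideal.span {u * s} ⊔ J.colon (Ideal.span {s} : Set R)
  have hK : K = ⊤ := by
    by_contra hK
    obtain ⟨n, hn, hKn⟩ := Ideal.exists_le_maximal K hK
    have hus : u * s ∈ n := hKn (Ideal.mem_sup_left (Ideal.mem_span_singleton_self _))
    by_cases hnm : n = m
    · subst hnm
      exact (hn.isPrime.mem_or_mem hus).elim hu hsm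
    · obtain ⟨t, ht, hst⟩ := hst n hn hnm
      refine ht (hKn (Ideal.mem_sup_right ?_))
      rw [Ideal.mem_colon_span_singleton]
      rwa [mul_comm]
  obtain ⟨x, hx, b, hb, hxb⟩ := Submodule.mem_sup.1 (K.eq_top_iff_one.1 hK)
  obtain ⟨a, rfl⟩ := Ideal.mem_span_singleton.1 hx
  rw [Ideal.mem_colon_span_singleton] at hb
  refine ⟨a * s, ⟨s, hsm, ?_⟩, fun n hn hnm => ?_⟩
  · have : s * (u * (a * s) - 1) = -(b * s) := by
      linear_combination s * hxb
    rw [this]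
    exact J.neg_mem hb
  · obtain ⟨t, ht, hst⟩ := hst n hn hnm
    refine ⟨t, ht, ?_⟩
    have : t * (a * s) = a * (s * t) := by ring
    rw [this]
    exact J.mul_mem_left _ hst

theorem LocalizedModule.mkLinearMap_eq_zero_iff_torsionOf {R : Type*} [CommRing R] {N : Type*}
    [AddCommGroup N] [Module R N] (p : Ideal R) [p.IsPrime] (x : N) :
    LocalizedModule.mkLinearMap p.primeCompl N x = 0 ↔ ¬ Ideal.torsionOf R N x ≤ p := by
  rw [IsLocalizedModule.eq_zero_iff p.primeCompl, SetLike.not_le_iff_exists]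
  constructor
  · rintro ⟨c, hc⟩
    exact ⟨c, (Ideal.mem_torsionOf_iff x _).2 hc, c.2⟩
  · rintro ⟨c, hc, hcp⟩
    exact ⟨⟨c, hcp⟩, (Ideal.mem_torsionOf_iff x _).1 hc⟩

/-- Over an `H`-h-local ring, a discrete module is the direct sum of its localisations at any
family of distinct maximal ideals that contains all the open ones. -/
theorem LinearTopologyOn.IsHLocal.nonempty_linearEquiv {R : Type u} [CommRing R]
    {H : LinearTopologyOn R} (hH : H.IsHLocal) {ι : Type*} (f : ι → MaximalSpectrum R)
    (hf : Function.Injective f) (hfH : ∀ m : MaximalSpectrum R, m.asIdeal ∈ H.sets → ∃ i, f i = m)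
    (N : Type u) [AddCommGroup N] [Module R N] (hN : H.IsDiscrete N) :
    Nonempty (N ≃ₗ[R] ⨁ i, LocalizedModule (f i).asIdeal.primeCompl N) := by
  classical
  let g : ∀ i, N →ₗ[R] LocalizedModule (f i).asIdeal.primeCompl N := fun i =>
    LocalizedModule.mkLinearMap _ N
  have hg : ∀ x, {i | g i x ≠ 0}.Finite := by
    intro x
    refine ((hH.1 _ (hN x)).preimage (f := fun i => (f i).asIdeal) ?_).subset ?_
    · exact fun i _ j _ hij => hf (MaximalSpectrum.ext hij)
    · intro i hi
      refine ⟨(f i).isMaximal, ?_⟩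
      by_contra hc
      exact hi ((LocalizedModule.mkLinearMap_eq_zero_iff_torsionOf _ x).2 hc)
  let φ := DirectSum.linearMapOfFiniteSupport g hg
  have hφ : ∀ x i, φ x i = g i x := DirectSum.linearMapOfFiniteSupport_apply g hg
  refine ⟨LinearEquiv.ofBijective φ ⟨?_, ?_⟩⟩
  · rw [← LinearMap.ker_eq_bot, LinearMap.ker_eq_bot']
    intro x hx
    by_contra hx0
    have hne : Ideal.torsionOf R N x ≠ ⊤ := by rwa [Ne, Ideal.torsionOf_eq_top_iff]
    obtain ⟨m, hm, hle⟩ := Ideal.exists_le_maximal _ hne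
    obtain ⟨i, hi⟩ := hfH ⟨m, hm⟩ (H.mem_of_le (hN x) hle)
    have h0 : g i x = 0 := by rw [← hφ, hx]; rfl
    refine (LocalizedModule.mkLinearMap_eq_zero_iff_torsionOf _ x).1 h0 ?_
    rwa [hi]
  · rw [← LinearMap.range_eq_top, eq_top_iff]
    intro z _
    induction z using DirectSum.induction_on with
    | zero => exact zero_mem _
    | add a b ha hb => exact add_mem (ha trivial) (hb trivial)
    | of i z =>
      obtain ⟨⟨x, u⟩, rfl⟩ := IsLocalizedModule.mk'_surjective (f i).asIdeal.primeCompl (g i) z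
      obtain ⟨y, ⟨s, hs, hsy⟩, hy⟩ :=
        hH.exists_local_lift (hN x) (f i).asIdeal (u := u) u.2
      refine ⟨y • x, DFinsupp.ext fun j => ?_⟩
      change φ (y • x) j =
        DirectSum.of (fun i => LocalizedModule (f i).asIdeal.primeCompl N) i _ j
      rw [hφ]
      by_cases hij : i = j
      · subst hij
        rw [DirectSum.of_eq_same, Function.uncurry_apply_pair, eq_comm,
          IsLocalizedModule.mk'_eq_iff, Submonoid.smul_def, ← map_smul,
          IsLocalizedModule.eq_iff_exists (f i).asIdeal.primeCompl]
        refine ⟨⟨s, hs⟩, ?_⟩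
        rw [Ideal.mem_torsionOf_iff] at hsy
        change s • x = s • (u : R) • y • x
        rw [eq_comm, ← sub_eq_zero, ← hsy]
        module
      · rw [DirectSum.of_eq_of_ne _ _ _ (Ne.symm hij)]
        obtain ⟨t, ht, hty⟩ := hy (f j).asIdeal (f j).isMaximal
          fun h => hij (hf (MaximalSpectrum.ext h.symm))
        rw [Ideal.mem_torsionOf_iff, mul_smul] at hty
        exact (IsLocalizedModule.eq_zero_iff (f j).asIdeal.primeCompl (g j)).2 ⟨⟨t, ht⟩, hty⟩

theorem LinearTopologyOn.isDiscrete_quotient {R : Type u} [CommRing R] (H : LinearTopologyOn R)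
    {J : Ideal R} (hJ : J ∈ H.sets) : H.IsDiscrete (R ⧸ J) := by
  intro x
  refine H.mem_of_le hJ fun r hr => ?_
  obtain ⟨x, rfl⟩ := Ideal.Quotient.mk_surjective x
  rw [Ideal.mem_torsionOf_iff, ← Ideal.Quotient.mk_eq_mk, ← Submodule.Quotient.mk_smul,
    Ideal.Quotient.mk_eq_mk, Ideal.Quotient.eq_zero_iff_mem]
  exact J.mul_mem_right _ hr

/-- If every discrete module is isomorphic to the direct sum of its localisations at a family of
maximal ideals containing all the open ones, then `R` is `H`-h-local. -/
theorem LinearTopologyOn.isHLocal_of_nonempty_linearEquiv {R : Type u} [CommRing R]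
    {H : LinearTopologyOn R} {ι : Type*} (f : ι → MaximalSpectrum R)
    (hfH : ∀ m : MaximalSpectrum R, m.asIdeal ∈ H.sets → ∃ i, f i = m)
    (h : ∀ (N : Type u) [AddCommGroup N] [Module R N], H.IsDiscrete N →
      Nonempty (N ≃ₗ[R] ⨁ i, LocalizedModule (f i).asIdeal.primeCompl N)) :
    H.IsHLocal := by
  classical
  have hmk : ∀ (J : Ideal R) (i : ι), J ≤ (f i).asIdeal →
      LocalizedModule.mkLinearMap (f i).asIdeal.primeCompl (R ⧸ J)
        (Ideal.Quotient.mk J 1) ≠ 0 := by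
    intro J i hJi h0
    rw [IsLocalizedModule.eq_zero_iff (f i).asIdeal.primeCompl] at h0
    obtain ⟨c, hc⟩ := h0
    rw [Submonoid.smul_def, ← Ideal.Quotient.mk_eq_mk, ← Submodule.Quotient.mk_smul,
      Ideal.Quotient.mk_eq_mk, Ideal.Quotient.eq_zero_iff_mem, smul_eq_mul, mul_one] at hc
    exact c.2 (hJi hc)
  refine ⟨fun J hJ => ?_, fun p hp hpp m n hm hn hpm hpn => ?_⟩
  · obtain ⟨e⟩ := h (R ⧸ J) (H.isDiscrete_quotient hJ)
    refine ((DFinsupp.support (e (Ideal.Quotient.mk J 1))).finite_toSet.image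
      fun i => (f i).asIdeal).subset ?_
    rintro m ⟨hm, hJm⟩
    obtain ⟨i, hi⟩ := hfH ⟨m, hm⟩ (H.mem_of_le hJ hJm)
    refine ⟨i, ?_, congrArg MaximalSpectrum.asIdeal hi⟩
    rw [Finset.mem_coe, DFinsupp.mem_support_iff]
    intro h0
    apply hmk J i (by rwa [hi])
    obtain ⟨y, hy⟩ := e.surjective (DirectSum.of _ i
      (LocalizedModule.mkLinearMap (f i).asIdeal.primeCompl (R ⧸ J) (Ideal.Quotient.mk J 1)))
    obtain ⟨r, rfl⟩ := Ideal.Quotient.mk_surjective y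
    have hr : Ideal.Quotient.mk J r = r • Ideal.Quotient.mk J 1 := by
      rw [← Ideal.Quotient.mk_eq_mk, ← Ideal.Quotient.mk_eq_mk, ← Submodule.Quotient.mk_smul,
        smul_eq_mul, mul_one]
    rw [hr, map_smul] at hy
    have := congrArg (fun z => z i) hy
    simp only [DirectSum.of_eq_same] at this
    rw [← this, DirectSum.smul_apply]
    exact (congrArg (r • ·) h0).trans (smul_zero r)
  · obtain ⟨e⟩ := h (R ⧸ p) (H.isDiscrete_quotient hp)
    obtain ⟨i, hi⟩ := hfH ⟨m, hm⟩ (H.mem_of_le hp hpm)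
    obtain ⟨j, hj⟩ := hfH ⟨n, hn⟩ (H.mem_of_le hp hpn)
    by_contra hmn
    have hij : i ≠ j := by
      rintro rfl
      exact hmn (congrArg MaximalSpectrum.asIdeal (hi.symm.trans hj))
    set x := DirectSum.of (fun i => LocalizedModule (f i).asIdeal.primeCompl (R ⧸ p)) i
      (LocalizedModule.mkLinearMap (f i).asIdeal.primeCompl (R ⧸ p) (Ideal.Quotient.mk p 1))
      with hx
    set y := DirectSum.of (fun i => LocalizedModule (f i).asIdeal.primeCompl (R ⧸ p)) j
      (LocalizedModule.mkLinearMap (f j).asIdeal.primeCompl (R ⧸ p) (Ideal.Quotient.mk p 1))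
      with hy
    have hx0 : x ≠ 0 := by
      intro hc
      apply hmk p i (by rwa [hi])
      have := congrArg (fun z => z i) hc
      rwa [hx, DirectSum.of_eq_same] at this
    have hy0 : y ≠ 0 := by
      intro hc
      apply hmk p j (by rwa [hj])
      have := congrArg (fun z => z j) hc
      rwa [hy, DirectSum.of_eq_same] at this
    obtain ⟨a, ha⟩ := Ideal.Quotient.mk_surjective (e.symm x)
    obtain ⟨b, hb⟩ := Ideal.Quotient.mk_surjective (e.symm y)
    have hab : a • y = b • x := by
      apply e.symm.injective
      rw [map_smul, map_smul, ← ha, ← hb, Algebra.smul_def, Algebra.smul_def,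
        Ideal.Quotient.algebraMap_eq, mul_comm]
    have hay : a • y = 0 := by
      refine DFinsupp.ext fun k => ?_
      change (a • y) k = 0
      by_cases hk : k = j
      · rw [hab, DirectSum.smul_apply, hx, DirectSum.of_eq_of_ne _ _ _ (by rw [hk]; exact hij.symm),
          smul_zero]
      · rw [DirectSum.smul_apply, hy, DirectSum.of_eq_of_ne _ _ _ hk, smul_zero]
    have hmem : a * b ∈ p := by
      rw [← Ideal.Quotient.eq_zero_iff_mem, ← smul_eq_mul, ← Ideal.Quotient.mk_eq_mk,
        Submodule.Quotient.mk_smul, Ideal.Quotient.mk_eq_mk, hb, ← map_smul, hay, map_zero]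
    rcases hpp.mem_or_mem hmem with hc | hc
    · rw [← Ideal.Quotient.eq_zero_iff_mem, ha, e.symm.map_eq_zero_iff] at hc
      exact hx0 hc
    · rw [← Ideal.Quotient.eq_zero_iff_mem, hb, e.symm.map_eq_zero_iff] at hc
      exact hy0 hc

/-- A domain whose fraction field is projective is a field. -/
theorem isField_of_projective_fractionRing (D : Type*) [CommRing D] [IsDomain D]
    [Module.Projective D (FractionRing D)] : IsField D := by
  obtain ⟨s, hs⟩ := Module.projective_def'.1 (inferInstance : Module.Projective D (FractionRing D))
  have hs1 : s 1 ≠ 0 := by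
    intro hc
    have := LinearMap.congr_fun hs 1
    simp [hc] at this
  obtain ⟨k, hk⟩ := Finsupp.ne_iff.1 hs1
  let g : FractionRing D →ₗ[D] D := (Finsupp.lapply k).comp s
  have hg : g 1 ≠ 0 := hk
  refine ⟨⟨0, 1, zero_ne_one⟩, mul_comm, fun {a} ha => ?_⟩
  have hda : g 1 * a ≠ 0 := mul_ne_zero hg ha
  refine ⟨g (algebraMap D (FractionRing D) (g 1 * a))⁻¹, mul_left_cancel₀ hg ?_⟩
  rw [← mul_assoc, ← smul_eq_mul (g 1 * a), ← map_smul, Algebra.smul_def, mul_inv_cancel₀, mul_one]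
  rwa [Ne, FaithfulSMul.algebraMap_eq_zero_iff]

/-- If the localisations at maximal ideals are projective and distinct maximal ideals are separated
by a pair of elements with zero product, then there are finitely many maximal ideals. -/
theorem finite_maximalSpectrum_of_projective_localization (S : Type*) [CommRing S]
    (hproj : ∀ m : MaximalSpectrum S, Module.Projective S (Localization.AtPrime m.asIdeal))
    (hsep : ∀ m n : MaximalSpectrum S, m ≠ n → ∃ s ∉ m.asIdeal, ∃ t ∉ n.asIdeal, s * t = 0) :
    Finite (MaximalSpectrum S) := by
  have key : ∀ m : MaximalSpectrum S, ∃ e ∉ m.asIdeal, ∀ n : MaximalSpectrum S, m ≠ n →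
      e ∈ n.asIdeal := by
    intro m
    obtain ⟨s, hs⟩ := Module.projective_def'.1 (hproj m)
    obtain ⟨k, hk⟩ : ∃ k, s 1 k ∉ m.asIdeal := by
      by_contra! hc
      have h1 := LinearMap.congr_fun hs 1
      rw [LinearMap.comp_apply, Finsupp.linearCombination_apply, LinearMap.id_apply] at h1
      have hmem : (1 : Localization.AtPrime m.asIdeal) ∈
          IsLocalRing.maximalIdeal (Localization.AtPrime m.asIdeal) := by
        rw [← h1]
        refine Ideal.sum_mem _ fun x _ => ?_
        dsimp only
        rw [Algebra.smul_def]
        exact Ideal.mul_mem_right _ _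
          ((IsLocalization.AtPrime.to_map_mem_maximal_iff _ m.asIdeal _).2 (hc x))
      exact Ideal.one_notMem _ hmem
    refine ⟨s 1 k, hk, fun n hmn => ?_⟩
    obtain ⟨a, ha, t, ht, hat⟩ := hsep m n hmn
    have ht0 : t • (1 : Localization.AtPrime m.asIdeal) = 0 := by
      rw [Algebra.smul_def, mul_one]
      exact (IsLocalization.map_eq_zero_iff m.asIdeal.primeCompl _ t).2 ⟨⟨a, ha⟩, hat⟩
    have : t * s 1 k = 0 := by
      rw [← smul_eq_mul, ← Finsupp.smul_apply, ← map_smul, ht0, map_zero, Finsupp.zero_apply]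
    exact (n.isMaximal.isPrime.mem_or_mem (this ▸ n.asIdeal.zero_mem)).resolve_left ht
  choose e he hen using key
  have htop : Ideal.span (Set.range e) = ⊤ := by
    by_contra hc
    obtain ⟨n, hn, hle⟩ := Ideal.exists_le_maximal _ hc
    exact he ⟨n, hn⟩ (hle (Ideal.subset_span ⟨_, rfl⟩))
  have h1 : (1 : S) ∈ Ideal.span (Set.range e) := htop ▸ Submodule.mem_top
  obtain ⟨c, hc⟩ := Finsupp.mem_ideal_span_range_iff_exists_finsupp.1 h1
  refine Set.finite_univ_iff.1 (c.support.finite_toSet.subset fun n _ => ?_)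
  by_contra hn
  refine n.asIdeal.one_notMem ?_
  rw [← hc]
  refine Ideal.sum_mem _ fun m hm => Ideal.mul_mem_left _ _ (hen m n ?_)
  rintro rfl
  exact hn hm

theorem LinearTopologyOn.isHLocal_of_isPerfectRing {R : Type u} [CommRing R]
    {H : LinearTopologyOn R} (h : ∀ J ∈ H.sets, IsPerfectRing (R ⧸ J)) : H.IsHLocal := by
  have hmax : ∀ p ∈ H.sets, p.IsPrime → p.IsMaximal := by
    intro p hp hpp
    have := h p hp (FractionRing (R ⧸ p)) (IsLocalization.flat _ (nonZeroDivisors (R ⧸ p)))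
    exact Ideal.Quotient.maximal_of_isField p (isField_of_projective_fractionRing (R ⧸ p))
  refine ⟨fun J hJ => ?_, fun p hp hpp m n hm hn hpm hpn => ?_⟩
  · have hfin : Finite (MaximalSpectrum (R ⧸ J)) := by
      refine finite_maximalSpectrum_of_projective_localization (R ⧸ J)
        (fun m => h J hJ _ (IsLocalization.flat _ m.asIdeal.primeCompl)) fun m n hmn => ?_
      refine exists_mul_mem_of_forall_prime_not_le ⊥ m.asIdeal n.asIdeal
        fun p hp _ hpm hpn => hmn (MaximalSpectrum.ext ?_)
      have hc : (p.comap (Ideal.Quotient.mk J)).IsMaximal := by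
        refine hmax _ (H.mem_of_le hJ ?_) inferInstance
        exact Ideal.mk_ker.symm.trans_le (Ideal.ker_le_comap _)
      have heq : ∀ q : MaximalSpectrum (R ⧸ J), p ≤ q.asIdeal →
          p.comap (Ideal.Quotient.mk J) = q.asIdeal.comap (Ideal.Quotient.mk J) :=
        fun q hpq => hc.eq_of_le (Ideal.comap_ne_top _ q.isMaximal.ne_top) (Ideal.comap_mono hpq)
      exact Ideal.comap_injective_of_surjective _ Ideal.Quotient.mk_surjective
        ((heq m hpm).symm.trans (heq n hpn))
    refine (Set.finite_range fun m : MaximalSpectrum (R ⧸ J) =>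
      m.asIdeal.comap (Ideal.Quotient.mk J)).subset ?_
    rintro m ⟨hm, hJm⟩
    have hcm : (m.map (Ideal.Quotient.mk J)).comap (Ideal.Quotient.mk J) = m := by
      rw [Ideal.comap_map_of_surjective _ Ideal.Quotient.mk_surjective, ← RingHom.ker_eq_comap_bot,
        Ideal.mk_ker, sup_eq_left.2 hJm]
    refine ⟨⟨m.map (Ideal.Quotient.mk J), ?_⟩, hcm⟩
    refine (Ideal.map_eq_top_or_isMaximal_of_surjective _
      Ideal.Quotient.mk_surjective hm).resolve_left fun hc => hm.ne_top ?_
    rw [← hcm, hc, Ideal.comap_top]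
  · have hpmax := hmax p hp hpp
    rw [← hpmax.eq_of_le hm.ne_top hpm, hpmax.eq_of_le hn.ne_top hpn]

theorem stmt18 (R : Type u) [CommRing R] (H : LinearTopologyOn R) :
    (H.IsHLocal ↔
      ∀ (N : Type u) [AddCommGroup N] [Module R N], H.IsDiscrete N →
        Nonempty (N ≃ₗ[R] ⨁ m : MaximalSpectrum R, LocalizedModule m.asIdeal.primeCompl N)) ∧
    (H.IsHLocal ↔
      ∀ (N : Type u) [AddCommGroup N] [Module R N], H.IsDiscrete N →
        Nonempty (N ≃ₗ[R] ⨁ m : {m : MaximalSpectrum R // m.asIdeal ∈ H.sets},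
          LocalizedModule m.1.asIdeal.primeCompl N)) ∧
    ((∀ J ∈ H.sets, IsPerfectRing (R ⧸ J)) → H.IsHLocal) := by
  have hid : ∀ m : MaximalSpectrum R, m.asIdeal ∈ H.sets → ∃ n, id n = m := fun m _ => ⟨m, rfl⟩
  have hval : ∀ m : MaximalSpectrum R, m.asIdeal ∈ H.sets →
      ∃ n : {m : MaximalSpectrum R // m.asIdeal ∈ H.sets}, n.1 = m := fun m hm => ⟨⟨m, hm⟩, rfl⟩
  exact ⟨⟨fun hH N _ _ hN => hH.nonempty_linearEquiv id Function.injective_id hid N hN,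
      LinearTopologyOn.isHLocal_of_nonempty_linearEquiv id hid⟩,
    ⟨fun hH N _ _ hN => hH.nonempty_linearEquiv Subtype.val Subtype.val_injective hval N hN,
      LinearTopologyOn.isHLocal_of_nonempty_linearEquiv Subtype.val hval⟩,
    LinearTopologyOn.isHLocal_of_isPerfectRing⟩
end

section
/- Let R be a commutative ring, (A, D_G) a 1-tilting cotorsion pair, and G the associated Gabriel topology. If the little finitistic dimension of R_G is 0 (every finitely presented R_G-module of finite projective dimension—admitting a resolution by finitely generated projectives—is projective), then G arises from a perfect localisation; equivalently, R_G is G-divisible. In particular, this holds if R_G is a perfect ring. -/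
universe u

open Finset in
/-- The telescope `S → S → S → ⋯` whose transition maps are the multiplications by the terms of a
sequence `a` has a flat direct limit. -/
theorem exists_flat_telescope {S : Type u} [CommRing S] (a : ℕ → S) :
    ∃ (M : ModuleCat.{u} S) (z : ℕ → M), Module.Flat S M ∧
      (∀ n m, n ≤ m → z n = (∏ k ∈ Ico n m, a k) • z m) ∧
      (∀ F : Finset M, ∃ n, ∀ x ∈ F, ∃ c : S, x = c • z n) ∧
      (∀ n s, s • z n = 0 → ∃ m, n ≤ m ∧ (∏ k ∈ Ico n m, a k) * s = 0) := by
  classical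
  let f : ∀ i j : ℕ, i ≤ j → S →ₗ[S] S := fun i j _ => LinearMap.mulLeft S (∏ k ∈ Ico i j, a k)
  have : DirectedSystem (fun _ : ℕ => S) (fun i j h => f i j h) :=
    { map_self := fun i x => by simp [f]
      map_map := fun k j i hij hjk x => by
        simp only [f, LinearMap.mulLeft_apply]
        rw [← prod_Ico_consecutive a hij hjk]
        ring }
  let M := Module.DirectLimit (fun _ : ℕ => S) f
  let z : ℕ → M := fun n => Module.DirectLimit.of S ℕ (fun _ => S) f n 1
  have hof : ∀ n s, Module.DirectLimit.of S ℕ (fun _ => S) f n s = s • z n := fun n s => by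
    rw [← map_smul, smul_eq_mul, mul_one]
  have hz : ∀ n m, n ≤ m → z n = (∏ k ∈ Ico n m, a k) • z m := fun n m h => by
    rw [← hof]
    change Module.DirectLimit.of S ℕ (fun _ => S) f n 1 = _
    rw [← Module.DirectLimit.of_f (hij := h)]
    simp [f]
  have hfin : ∀ F : Finset M, ∃ n, ∀ x ∈ F, ∃ c : S, x = c • z n := by
    intro F
    induction F using Finset.induction_on with
    | empty => exact ⟨0, by simp⟩
    | insert y F _ ih =>
      obtain ⟨n, hn⟩ := ih
      obtain ⟨m, d, rfl⟩ := Module.DirectLimit.exists_of y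
      refine ⟨max n m, fun x hx => ?_⟩
      rcases Finset.mem_insert.1 hx with rfl | hx
      · exact ⟨d * ∏ k ∈ Ico m (max n m), a k, by
          rw [hof, mul_smul, ← hz _ _ (le_max_right n m)]⟩
      · obtain ⟨c, rfl⟩ := hn x hx
        exact ⟨c * ∏ k ∈ Ico n (max n m), a k, by rw [mul_smul, ← hz _ _ (le_max_left n m)]⟩
  have hzero : ∀ n s, s • z n = 0 → ∃ m, n ≤ m ∧ (∏ k ∈ Ico n m, a k) * s = 0 := by
    intro n s h
    rw [← hof] at h
    obtain ⟨m, hnm, h⟩ := Module.DirectLimit.of.zero_exact h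
    exact ⟨m, hnm, h⟩
  refine ⟨ModuleCat.of S M, z, Module.Flat.of_forall_isTrivialRelation ?_, hz, hfin, hzero⟩
  intro l g x hgx
  obtain ⟨n, hn⟩ := hfin (univ.image x)
  choose c hc using fun i => hn (x i) (mem_image_of_mem x (mem_univ i))
  have h0 : (∑ i, g i * c i) • z n = 0 := by
    rw [sum_smul, ← hgx]
    exact sum_congr rfl fun i _ => by rw [hc i, mul_smul]
  obtain ⟨m, hnm, hm⟩ := hzero n _ h0
  refine ⟨1, fun i _ => (∏ k ∈ Ico n m, a k) * c i, fun _ => z m, fun i => ?_, fun _ => ?_⟩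
  · rw [hc i, hz n m hnm]
    simp [mul_smul, smul_comm (c i)]
  · rw [← hm, mul_sum]
    exact sum_congr rfl fun i _ => by ring

open Finset in
/-- Over a perfect ring the partial products of a sequence eventually generate the same ideal. -/
theorem IsPerfectRing.exists_prod_dvd_prod {S : Type u} [CommRing S] (hS : IsPerfectRing S)
    (a : ℕ → S) : ∃ N, ∀ m, N ≤ m → ∏ k ∈ range m, a k ∣ ∏ k ∈ range N, a k := by
  obtain ⟨M, z, hflat, hz, hfin, hzero⟩ := exists_flat_telescope a
  obtain ⟨s, hs⟩ := Module.projective_def'.1 (hS M hflat)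
  obtain ⟨n, hn⟩ := hfin (s (z 0)).support
  choose! b hb using hn
  let t : ℕ → S := fun m => ∑ x ∈ (s (z 0)).support, s (z m) x * b x
  have ht : ∀ m, n ≤ m → t n = (∏ k ∈ Ico n m, a k) * t m := fun m h => by
    simp only [t, mul_sum]
    refine sum_congr rfl fun x _ => ?_
    rw [hz n m h, map_smul, Finsupp.smul_apply, smul_eq_mul, mul_assoc]
  have hz0 : z 0 = (∏ k ∈ range n, a k) • z n := by
    rw [range_eq_Ico]; exact hz 0 n n.zero_le
  have h0 : ((∏ k ∈ range n, a k) * (1 - t n)) • z n = 0 := by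
    have h1 : z 0 = ((∏ k ∈ range n, a k) * t n) • z n := by
      conv_lhs => rw [← LinearMap.id_apply (R := S) (z 0), ← hs]
      rw [LinearMap.comp_apply, Finsupp.linearCombination_apply, Finsupp.sum, mul_sum, sum_smul]
      refine sum_congr rfl fun x hx => ?_
      have hx' : s (z 0) x = (∏ k ∈ range n, a k) * s (z n) x := by
        rw [hz0, map_smul, Finsupp.smul_apply, smul_eq_mul]
      rw [hx', ← mul_assoc, mul_smul _ (b x), ← hb x hx, id]
    rw [mul_sub, mul_one, sub_smul, ← h1, ← hz0, sub_self]
  obtain ⟨N, hnN, hN⟩ := hzero n _ h0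
  refine ⟨N, fun m hm => ⟨(∏ k ∈ Ico n N, a k) * t m, ?_⟩⟩
  have h2 := ht m (hnN.trans hm)
  rw [← prod_Ico_consecutive a hnN hm] at h2
  rw [← prod_range_mul_prod_Ico a hm, ← prod_range_mul_prod_Ico a hnN]
  linear_combination hN + (∏ k ∈ range n, a k) * (∏ k ∈ Ico n N, a k) * h2

/-- A perfect commutative ring satisfies the descending chain condition on principal ideals. -/
theorem IsPerfectRing.wellFounded_dvd {S : Type u} [CommRing S] (hS : IsPerfectRing S) :
    WellFounded fun x y : S => y ∣ x ∧ ¬ x ∣ y := by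
  refine wellFounded_iff_isEmpty_descending_chain.2 ⟨fun ⟨f, hf⟩ => ?_⟩
  choose c hc using fun n => (hf n).1
  let a : ℕ → S := fun n => Nat.casesOn n (f 0) c
  have ha : ∀ n, ∏ k ∈ Finset.range (n + 1), a k = f n := by
    intro n
    induction n with
    | zero => simp [a]
    | succ n ih => rw [Finset.prod_range_succ, ih, hc n]
  obtain ⟨N, hN⟩ := hS.exists_prod_dvd_prod a
  apply (hf N).2
  rw [← ha N, ← ha (N + 1)]
  exact (hN (N + 1 + 1) (by omega)).trans
    (Finset.prod_dvd_prod_of_subset _ _ _ (Finset.range_mono (Nat.le_succ N)))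

/-- In a perfect commutative ring a proper ideal has a nonzero annihilator. -/
theorem IsPerfectRing.eq_top_of_annihilator {S : Type u} [CommRing S] (hS : IsPerfectRing S)
    (J : Ideal S) (hJ : ∀ q, (∀ x ∈ J, x * q = 0) → q = 0) : J = ⊤ := by
  by_contra hne
  obtain ⟨m, hm, hJm⟩ := J.exists_le_maximal hne
  have hmin {p : S → Prop} (hp : ∃ x, p x) : ∃ x, p x ∧ ∀ y, p y → x ∣ y → y ∣ x := by
    obtain ⟨x, hx, h⟩ := hS.wellFounded_dvd.has_min {x | p x} hp
    exact ⟨x, hx, fun y hy hxy => by_contra fun hyx => h y hy ⟨hxy, hyx⟩⟩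
  obtain ⟨e, he, hemin⟩ := hmin (p := (· ∉ m)) ⟨1, m.ne_top_iff_one.1 hm.ne_top⟩
  have he0 : e ≠ 0 := fun h => he (h ▸ m.zero_mem)
  obtain ⟨y, ⟨hy0, t, rfl⟩, hymin⟩ := hmin (p := fun y => y ≠ 0 ∧ e ∣ y) ⟨e, he0, dvd_rfl⟩
  refine hy0 (hJ _ fun c hc => by_contra fun hcy => ?_)
  obtain ⟨r, hr⟩ := hymin (c * (e * t)) ⟨hcy, (dvd_mul_right e t).mul_left c⟩ (dvd_mul_left _ _)
  have h1 : 1 - r * c ∉ m := fun h => m.ne_top_iff_one.1 hm.ne_top <| by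
    simpa using m.add_mem h (m.mul_mem_left r (hJm hc))
  obtain ⟨s, hs⟩ := hemin (e * (1 - r * c))
    (fun h => (hm.isPrime.mem_or_mem h).elim he h1) (dvd_mul_right _ _)
  apply hy0
  linear_combination t * hs + s * hr

/-- If the little finitistic dimension of `S` is zero, then a finite family with zero annihilator
generates the unit ideal. -/
theorem exists_sum_mul_eq_one_of_fgProjDim {S : Type u} [CommRing S]
    (hS : ∀ (M : Type u) [AddCommGroup M] [Module S M],
      (∃ n, FGProjDimLE S n M) → Module.Projective S M)
    {n : ℕ} (a : Fin n → S) (ha : ∀ q, (∀ i, a i * q = 0) → q = 0) :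
    ∃ b : Fin n → S, ∑ i, b i * a i = 1 := by
  let f : S →ₗ[S] (Fin n → S) := LinearMap.toSpanSingleton S _ a
  have hf : Function.Injective f := (injective_iff_map_eq_zero f).2 fun q hq => ha q fun i => by
    rw [mul_comm]; exact congrFun hq i
  let e := LinearEquiv.ofInjective f hf
  have hproj : Module.Projective S ((Fin n → S) ⧸ LinearMap.range f) := by
    refine hS _ ⟨1, n, (LinearMap.range f).mkQ, Submodule.mkQ_surjective _, ?_⟩
    have hk : LinearMap.range f = LinearMap.ker (LinearMap.range f).mkQ :=
      (Submodule.ker_mkQ _).symm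
    let e' := e.trans (LinearEquiv.ofEq _ _ hk)
    exact ⟨Module.Finite.equiv e', Module.Projective.of_equiv e'⟩
  obtain ⟨s, hs⟩ := Module.projective_lifting_property (LinearMap.range f).mkQ LinearMap.id
    (Submodule.mkQ_surjective _)
  let p : (Fin n → S) →ₗ[S] LinearMap.range f :=
    (LinearMap.id - s ∘ₗ (LinearMap.range f).mkQ).codRestrict _ fun y => by
      refine (Submodule.Quotient.mk_eq_zero _).1 ?_
      rw [← Submodule.mkQ_apply]
      have := LinearMap.congr_fun hs ((LinearMap.range f).mkQ y)
      simp only [LinearMap.comp_apply, LinearMap.id_apply] at this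
      rw [LinearMap.sub_apply, map_sub, LinearMap.comp_apply, this, LinearMap.id_apply, sub_self]
  let ρ : (Fin n → S) →ₗ[S] S := e.symm.toLinearMap ∘ₗ p
  have hρ : ρ a = 1 := by
    have ha' : a = f 1 := by simp [f]
    have hq : (LinearMap.range f).mkQ a = 0 := by
      rw [← LinearMap.mem_ker, Submodule.ker_mkQ, ha']
      exact ⟨1, rfl⟩
    change e.symm (p a) = 1
    rw [LinearEquiv.symm_apply_eq]
    ext1
    change a - s ((LinearMap.range f).mkQ a) = f 1
    rw [hq, map_zero, sub_zero, ← ha']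
  refine ⟨fun i => ρ (Pi.single i 1), ?_⟩
  refine Eq.trans ?_ ((LinearMap.pi_apply_eq_sum_univ ρ a).symm.trans hρ)
  refine Finset.sum_congr rfl fun i _ => ?_
  have hi : (Pi.single i 1 : Fin n → S) = fun j => if i = j then 1 else 0 := by
    ext j
    simp [Pi.single_apply, eq_comm]
  rw [← hi, smul_eq_mul, mul_comm]

namespace GabrielTopology

variable {R : Type u} [CommRing R] {G : GabrielTopology R} {Q : Type u} [CommRing Q] [Algebra R Q]

theorem exists_sets_smul_mem_range (hQ : G.IsRingOfQuotients Q) (F : Finset Q) :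
    ∃ J ∈ G.sets, ∀ x ∈ J, ∀ q ∈ F, ∃ r : R, x • q = algebraMap R Q r := by
  classical
  induction F using Finset.induction_on with
  | empty => exact ⟨⊤, G.top_mem, by simp⟩
  | insert q F _ ih =>
    obtain ⟨J, hJ, h⟩ := ih
    obtain ⟨K, hK, hq⟩ := hQ.coker_torsion q
    refine ⟨J ⊓ K, G.inf_mem hJ hK, fun x hx q' hq' => ?_⟩
    rcases Finset.mem_insert.1 hq' with rfl | hq'
    · exact hq x hx.2
    · exact h x hx.1 q' hq'

theorem IsRingOfQuotients.algebraMap_injective (hQ : G.IsRingOfQuotients Q) (hG : G.Faithful) :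
    Function.Injective (algebraMap R Q) :=
  (injective_iff_map_eq_zero _).2 fun r hr => hG r (hQ.ker_torsion r hr)

theorem smul_top_eq_top_iff {n : ℕ} (k : Fin n → R) :
    Ideal.span (Set.range k) • (⊤ : Submodule R Q) = ⊤ ↔
      ∃ s : Fin n → Q, ∑ i, s i * algebraMap R Q (k i) = 1 := by
  rw [Ideal.smul_top_eq_map, Submodule.restrictScalars_eq_top_iff, Ideal.eq_top_iff_one,
    Ideal.map_span, ← Set.range_comp, Ideal.mem_span_range_iff_exists_fun]
  rfl

/-- If `R_G` is `G`-divisible, then every finite set of elements of `R_G` is multiplied into the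
image of `R` by each term of a finite family of `R` that generates the unit ideal of `R_G`. -/
theorem exists_common_denominators (hfg : G.FinitelyGenerated) (hQ : G.IsRingOfQuotients Q)
    (hdiv : G.IsDivisible Q) (F : Finset Q) :
    ∃ (n : ℕ) (k : Fin n → R) (s : Fin n → Q), ∑ j, s j * algebraMap R Q (k j) = 1 ∧
      ∀ j, ∀ q ∈ F, ∃ r : R, algebraMap R Q (k j) * q = algebraMap R Q r := by
  obtain ⟨J, hJ, h⟩ := exists_sets_smul_mem_range hQ F
  obtain ⟨K, hK, hKJ, hKfg⟩ := hfg J hJ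
  obtain ⟨n, k, rfl⟩ := Submodule.fg_iff_exists_fin_generating_family.1 hKfg
  obtain ⟨s, hs⟩ := (smul_top_eq_top_iff k).1 (hdiv _ hK)
  refine ⟨n, k, s, hs, fun j q hq => ?_⟩
  rw [← Algebra.smul_def]
  exact h _ (hKJ (Submodule.subset_span ⟨j, rfl⟩)) q hq

theorem isPerfectLocalization_of_isDivisible (hG : G.Faithful) (hfg : G.FinitelyGenerated)
    (hQ : G.IsRingOfQuotients Q) (hdiv : G.IsDivisible Q) : G.IsPerfectLocalization Q := by
  classical
  have hinj := hQ.algebraMap_injective hG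
  refine ⟨Module.Flat.of_forall_isTrivialRelation ?_, ?_, fun J => ⟨hdiv J, fun hJ => ?_⟩⟩
  · intro l f x hfx
    obtain ⟨n, k, s, hs, hk⟩ := exists_common_denominators hfg hQ hdiv (Finset.univ.image x)
    choose r hr using fun j i => hk j (x i) (Finset.mem_image_of_mem x (Finset.mem_univ i))
    refine ⟨n, fun i j => r j i, s, fun i => ?_, fun j => hinj ?_⟩
    · rw [← one_mul (x i), ← hs, Finset.sum_mul]
      refine Finset.sum_congr rfl fun j _ => ?_
      rw [Algebra.smul_def, ← hr j i]
      ring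
    · rw [map_sum, map_zero, ← mul_zero (algebraMap R Q (k j)), ← hfx, Finset.mul_sum]
      refine Finset.sum_congr rfl fun i _ => ?_
      rw [map_mul, ← hr j i, Algebra.smul_def]
      ring
  · intro S _ f g hfg'
    have halg : ∀ r, f (algebraMap R Q r) = g (algebraMap R Q r) := RingHom.congr_fun hfg'
    ext q
    obtain ⟨n, k, s, hs, hk⟩ := exists_common_denominators hfg hQ hdiv {q}
    rw [← sub_eq_zero, ← one_mul (f q - g q), ← map_one f, ← hs, map_sum, Finset.sum_mul]
    refine Finset.sum_eq_zero fun j _ => ?_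
    obtain ⟨r, hr⟩ := hk j q (Finset.mem_singleton_self q)
    have h1 := halg r
    rw [← hr, map_mul, map_mul, ← halg] at h1
    rw [map_mul]
    linear_combination f (s j) * h1
  · have h1 : (1 : Q) ∈ J • (⊤ : Submodule R Q) := by rw [hJ]; exact Submodule.mem_top
    have hmem : ∀ q ∈ J • (⊤ : Submodule R Q), ∃ K ∈ G.sets, ∀ x ∈ K, ∃ r ∈ J,
        x • q = algebraMap R Q r := by
      intro q hq
      induction hq using Submodule.smul_induction_on' with
      | smul c hc q _ =>
        obtain ⟨K, hK, h⟩ := hQ.coker_torsion q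
        refine ⟨K, hK, fun x hx => ?_⟩
        obtain ⟨r, hr⟩ := h x hx
        refine ⟨c * r, J.mul_mem_right r hc, ?_⟩
        rw [smul_comm, hr, Algebra.smul_def, map_mul]
      | add p _ q _ hp hq =>
        obtain ⟨K, hK, h⟩ := hp
        obtain ⟨L, hL, h'⟩ := hq
        refine ⟨K ⊓ L, G.inf_mem hK hL, fun x hx => ?_⟩
        obtain ⟨r, hr, hxr⟩ := h x hx.1
        obtain ⟨r', hr', hxr'⟩ := h' x hx.2
        exact ⟨r + r', J.add_mem hr hr', by rw [smul_add, hxr, hxr', map_add]⟩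
    obtain ⟨K, hK, h⟩ := hmem 1 h1
    refine G.mem_of_le hK fun x hx => ?_
    obtain ⟨r, hr, hxr⟩ := h x hx
    rw [← Algebra.algebraMap_eq_smul_one] at hxr
    rwa [hinj hxr]

/-- The extension of an ideal of `G` to `R_G` has zero annihilator. -/
theorem IsRingOfQuotients.eq_zero_of_mul_eq_zero (hQ : G.IsRingOfQuotients Q) {n : ℕ}
    {k : Fin n → R} (hk : Ideal.span (Set.range k) ∈ G.sets) (q : Q)
    (hq : ∀ i, algebraMap R Q (k i) * q = 0) : q = 0 := by
  refine hQ.torsionFree q (G.mem_of_le hk (Ideal.span_le.2 ?_))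
  rintro _ ⟨i, rfl⟩
  rw [SetLike.mem_coe, Ideal.mem_torsionOf_iff, Algebra.smul_def, hq i]

/-- If finite families of `R_G` with zero annihilator generate the unit ideal, then `R_G` is
`G`-divisible. -/
theorem isDivisible_of_exists_sum_mul_eq_one (hfg : G.FinitelyGenerated)
    (hQ : G.IsRingOfQuotients Q)
    (h : ∀ {n : ℕ} (a : Fin n → Q), (∀ q, (∀ i, a i * q = 0) → q = 0) →
      ∃ b : Fin n → Q, ∑ i, b i * a i = 1) : G.IsDivisible Q := by
  intro J hJ
  obtain ⟨K, hK, hKJ, hKfg⟩ := hfg J hJ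
  obtain ⟨n, k, rfl⟩ := Submodule.fg_iff_exists_fin_generating_family.1 hKfg
  exact top_unique <| ((smul_top_eq_top_iff k).2
    (h _ (hQ.eq_zero_of_mul_eq_zero hK))).ge.trans (Submodule.smul_mono_left hKJ)

end GabrielTopology

theorem stmt19 (R : Type u) [CommRing R] (G : GabrielTopology R)
    (hG : G.IsTiltingTopology)
    (Q : Type u) [CommRing Q] [Algebra R Q] (hQ : G.IsRingOfQuotients Q) :
    ((∀ (M : Type u) [AddCommGroup M] [Module Q M],
        (∃ n, FGProjDimLE Q n M) → Module.Projective Q M) →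
      G.IsPerfectLocalization Q ∧ G.IsDivisible Q) ∧
    (IsPerfectRing Q → G.IsPerfectLocalization Q ∧ G.IsDivisible Q) := by
  obtain ⟨hfaithful, hfg, -⟩ := hG
  refine ⟨fun hS => ?_, fun hS => ?_⟩
  · have hdiv := GabrielTopology.isDivisible_of_exists_sum_mul_eq_one hfg hQ
      fun a ha => exists_sum_mul_eq_one_of_fgProjDim hS a ha
    exact ⟨GabrielTopology.isPerfectLocalization_of_isDivisible hfaithful hfg hQ hdiv, hdiv⟩
  · have hdiv : G.IsDivisible Q :=
      GabrielTopology.isDivisible_of_exists_sum_mul_eq_one hfg hQ fun a ha => by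
        rw [← Ideal.mem_span_range_iff_exists_fun, ← Ideal.eq_top_iff_one]
        exact hS.eq_top_of_annihilator _ fun q hq =>
          ha q fun i => hq _ (Ideal.subset_span ⟨i, rfl⟩)
    exact ⟨GabrielTopology.isPerfectLocalization_of_isDivisible hfaithful hfg hQ hdiv, hdiv⟩
end
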